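/- arXiv:1407.6551 — 2 statements merged into one kernel-verified Lean document; each statement's English description precedes it below -/
import Mathlib

section
/- Let Θ be the characteristics of the kinetic Kuramoto model for identical oscillators with initial measure ρ₀, and suppose the solution is not stationary. Then ρ(t,·) converges in the weak-* sense, as t → ∞, to a stationary state of type (c₁,c₂): there exist φ* ∈ ℝ and constants c₁ ≥ c₂ ≥ 0 with c₁ + c₂ = 1 such that for every continuous 2π-periodic function h, ∫ h(Θ(t,θ)) dρ₀(θ) → c₁ h(φ*) + c₂ h(φ* + π); here c₂ is the ρ₀-measure of a single point α of the circle. -/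
open MeasureTheory Filter Real

namespace KK

lemma mono_Ici {f f' : ℝ → ℝ} {T : ℝ} (h : ∀ t ≥ T, HasDerivAt f (f' t) t)
    (h0 : ∀ t ≥ T, 0 ≤ f' t) {s t : ℝ} (hs : T ≤ s) (hst : s ≤ t) : f s ≤ f t := by
  have : MonotoneOn f (Set.Ici T) := by
    apply monotoneOn_of_deriv_nonneg (convex_Ici T)
    · intro x hx
      exact (h x hx).continuousAt.continuousWithinAt
    · intro x hx
      rw [interior_Ici] at hx
      exact (h x (le_of_lt hx)).differentiableAt.differentiableWithinAt
    · intro x hx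
      rw [interior_Ici] at hx
      rw [(h x (le_of_lt hx)).deriv]
      exact h0 x (le_of_lt hx)
  exact this hs (le_trans hs hst) hst

lemma hasDerivAt_expmul (a t : ℝ) : HasDerivAt (fun s => exp (a * s)) (a * exp (a * t)) t := by
  have h1 : HasDerivAt (fun s : ℝ => a * s) a t := by
    simpa using (hasDerivAt_id t).const_mul a
  have := h1.exp
  rwa [mul_comm] at this

/-- forward comparison -/
lemma exp_compare {f f' : ℝ → ℝ} {T a c : ℝ} (h : ∀ t ≥ T, HasDerivAt f (f' t) t)
    (h0 : ∀ t ≥ T, f' t ≤ a * (f t - c)) {s t : ℝ} (hs : T ≤ s) (hst : s ≤ t) :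
    f t - c ≤ (f s - c) * exp (a * (t - s)) := by
  have key : ∀ t ≥ T, HasDerivAt (fun t => -((f t - c) * exp (-a * t)))
      (-(f' t * exp (-a * t) + (f t - c) * (-a * exp (-a * t)))) t := fun t ht =>
    (((h t ht).sub_const c).mul (hasDerivAt_expmul (-a) t)).neg
  have := mono_Ici key (fun t ht => by
    have := h0 t ht
    have he := exp_pos (-a * t)
    nlinarith) hs hst
  have e1 : exp (a * (t - s)) = exp (-a * s) * exp (a * t) := by
    rw [← exp_add]; congr 1; ring
  have e2 : exp (-a * t) * exp (a * t) = 1 := by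
    rw [← exp_add]; simp
  rw [e1]
  have he := exp_pos (a * t)
  have h3 : (f t - c) * exp (-a * t) ≤ (f s - c) * exp (-a * s) := by linarith
  calc f t - c = (f t - c) * (exp (-a * t) * exp (a * t)) := by rw [e2, mul_one]
    _ = ((f t - c) * exp (-a * t)) * exp (a * t) := by ring
    _ ≤ ((f s - c) * exp (-a * s)) * exp (a * t) := by gcongr
    _ = _ := by ring

lemma tendsto_exp_dec {a : ℝ} (ha : 0 < a) (K s : ℝ) :
    Tendsto (fun t => K * exp (-a * (t - s))) atTop (nhds 0) := by
  have h1 : Tendsto (fun t : ℝ => a * (t - s)) atTop atTop :=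
    (tendsto_atTop_add_const_right atTop (-s) tendsto_id).const_mul_atTop ha
  have := (tendsto_exp_neg_atTop_nhds_zero.comp h1).const_mul K
  simpa [Function.comp_def] using this

lemma stable {f f' δ : ℝ → ℝ} {T a : ℝ} (ha : 0 < a) (h : ∀ t ≥ T, HasDerivAt f (f' t) t)
    (hf : ∀ t ≥ T, 0 ≤ f t)
    (h0 : ∀ t ≥ T, f' t ≤ -a * f t + δ t) (hδ : Tendsto δ atTop (nhds 0)) :
    Tendsto f atTop (nhds 0) := by
  rw [Metric.tendsto_atTop]
  intro ε hε
  have h1 : ∀ᶠ t in atTop, δ t < a * (ε / 2) := hδ.eventually_lt_const (by positivity)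
  obtain ⟨T1, hT1⟩ := eventually_atTop.1 h1
  set T2 := max T T1
  have h2 : ∀ t ≥ T2, f t - ε/2 ≤ (f T2 - ε/2) * exp (-a * (t - T2)) := fun t ht =>
    exp_compare (T := T2) (fun t ht => h t (le_trans (le_max_left _ _) ht))
      (fun t ht => by
        have := h0 t (le_trans (le_max_left _ _) ht)
        have := hT1 t (le_trans (le_max_right _ _) ht)
        nlinarith) le_rfl ht
  have h3 := (tendsto_exp_dec ha (f T2 - ε/2) T2).eventually_lt_const (half_pos hε)
  obtain ⟨T3, hT3⟩ := eventually_atTop.1 h3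
  refine ⟨max T2 T3, fun t ht => ?_⟩
  have h4 := h2 t (le_trans (le_max_left _ _) ht)
  have h5 := hT3 t (le_trans (le_max_right _ _) ht)
  have h6 := hf t (le_trans (le_max_left _ _) (le_trans (le_max_left _ _) ht))
  rw [Real.dist_eq, sub_zero, abs_of_nonneg h6]
  linarith

lemma unstable {f f' δ : ℝ → ℝ} {T a M : ℝ} (ha : 0 < a) (h : ∀ t ≥ T, HasDerivAt f (f' t) t)
    (hf : ∀ t ≥ T, 0 ≤ f t) (hM : ∀ t ≥ T, f t ≤ M)
    (h0 : ∀ t ≥ T, a * f t - δ t ≤ f' t) (hδ : Tendsto δ atTop (nhds 0)) :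
    Tendsto f atTop (nhds 0) := by
  rw [Metric.tendsto_atTop]
  intro ε hε
  have h1 : ∀ᶠ t in atTop, δ t < a * (ε / 2) := hδ.eventually_lt_const (by positivity)
  obtain ⟨T1, hT1⟩ := eventually_atTop.1 h1
  set T2 := max T T1
  refine ⟨T2, fun s hs => ?_⟩
  have h6 := hf s (le_trans (le_max_left _ _) hs)
  rw [Real.dist_eq, sub_zero, abs_of_nonneg h6]
  by_contra hcon
  push Not at hcon
  have h2 : ∀ t ≥ s, -f t - (-(ε/2)) ≤ (-f s - (-(ε/2))) * exp (a * (t - s)) := fun t ht =>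
    exp_compare (T := T2) (f := fun t => - f t) (f' := fun t => - f' t)
      (fun t ht => (h t (le_trans (le_max_left _ _) ht)).neg)
      (fun t ht => by
        have := h0 t (le_trans (le_max_left _ _) ht)
        have := hT1 t (le_trans (le_max_right _ _) ht)
        nlinarith) hs ht
  have hM0 := hM s (le_trans (le_max_left _ _) hs)
  set t := s + (M / (ε / 2)) / a
  have hst : s ≤ t := by
    have : 0 ≤ (M / (ε / 2)) / a := by apply div_nonneg (div_nonneg _ _) ha.le <;> linarith
    simp only [t]; linarith
  have h3 := h2 t hst
  have h4 := hM t (le_trans (le_trans (le_max_left _ _) hs) hst)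
  have h5 : M / (ε/2) + 1 ≤ exp (a * (t - s)) := by
    have : a * (t - s) = M / (ε / 2) := by simp only [t]; field_simp; ring
    rw [this]
    exact add_one_le_exp _
  have h7 : (f s - ε/2) * exp (a * (t-s)) ≤ M - ε / 2 := by linarith
  have h8 : (ε / 2) * (M / (ε/2) + 1) ≤ (f s - ε/2) * exp (a * (t-s)) := by
    apply mul_le_mul _ h5 _ _
    · linarith
    · have : 0 ≤ M / (ε/2) := div_nonneg (by linarith) (by linarith)
      linarith
    · linarith
  have h9 : (ε / 2) * (M / (ε/2) + 1) = M + ε/2 := by field_simp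
  linarith

/-- Barbalat -/
lemma barbalat {F E : ℝ → ℝ} {T L M : ℝ} (hL : 0 < L) (h : ∀ t ≥ T, HasDerivAt F (E t) t)
    (hE : ∀ t ≥ T, 0 ≤ E t) (hM : ∀ t ≥ T, F t ≤ M)
    (hlip : ∀ s ≥ T, ∀ t ≥ s, E s - L * (t - s) ≤ E t) :
    Tendsto E atTop (nhds 0) := by
  have hmono : ∀ s t, T ≤ s → s ≤ t → F s ≤ F t := fun s t => mono_Ici h hE
  -- E s ^2 ≤ 4 L (F (s + E s/(2L)) - F s)
  set l := sSup (F '' Set.Ici T)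
  have hbdd : BddAbove (F '' Set.Ici T) := ⟨M, by rintro _ ⟨t, ht, rfl⟩; exact hM t ht⟩
  have hle : ∀ t ≥ T, F t ≤ l := fun t ht => le_csSup hbdd ⟨t, ht, rfl⟩
  have key : ∀ s ≥ T, E s ^ 2 ≤ 4 * L * (l - F s) := by
    intro s hs
    set d := E s / (2 * L)
    have hd : 0 ≤ d := div_nonneg (hE s hs) (by linarith)
    have h1 : F s + (E s / 2) * d ≤ F (s + d) := by
      -- MVT
      rcases hd.eq_or_lt with hd0 | hd0
      · rw [← hd0]; simp
      obtain ⟨c, hc, hc2⟩ := exists_hasDerivAt_eq_slope F E (show s < s + d by linarith)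
        (fun x hx => (h x (le_trans hs hx.1)).continuousAt.continuousWithinAt)
        (fun x hx => h x (le_trans hs hx.1.le))
      have := hlip s hs c hc.1.le
      have h3 : L * (c - s) ≤ L * d := by gcongr; linarith [hc.2]
      have h4 : L * d = E s / 2 := by simp only [d]; field_simp
      have h5 : E s / 2 ≤ (F (s + d) - F s) / (s + d - s) := by rw [← hc2]; linarith
      rw [add_sub_cancel_left, le_div_iff₀ hd0] at h5
      linarith
    have h2 := hle (s + d) (by linarith)
    have h3 : (E s / 2) * d = E s ^ 2 / (4 * L) := by simp only [d]; field_simp; ring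
    have h4 : E s ^ 2 / (4 * L) ≤ l - F s := by linarith
    rw [div_le_iff₀ (by positivity)] at h4
    linarith
  have hFl : Tendsto F atTop (nhds l) := by
    rw [Metric.tendsto_atTop]
    intro ε hε
    obtain ⟨_, ⟨t0, ht0, rfl⟩, h2⟩ := exists_lt_of_lt_csSup (s := F '' Set.Ici T) ⟨F T, T, Set.self_mem_Ici, rfl⟩
      (show l - ε < l by linarith)
    refine ⟨t0, fun t ht => ?_⟩
    have := hmono t0 t ht0 ht
    have := hle t (le_trans ht0 ht)
    rw [Real.dist_eq, abs_lt]
    constructor <;> linarith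
  have hsq : Tendsto (fun t => 4 * L * (l - F t)) atTop (nhds 0) := by
    have := (hFl.const_sub l).const_mul (4 * L)
    simpa using this
  have hsq2 : Tendsto (fun t => √(4 * L * (l - F t))) atTop (nhds 0) := by
    have := hsq.sqrt
    simpa using this
  refine squeeze_zero' (eventually_atTop.2 ⟨T, hE⟩) (eventually_atTop.2 ⟨T, fun t ht => ?_⟩) hsq2
  exact le_sqrt_of_sq_le (key t ht)

/-- stability of solutions -/
lemma ode_compare {f g a b : ℝ → ℝ} (ha : ∀ t ≥ 0, |a t| ≤ 1) (hb : ∀ t ≥ 0, |b t| ≤ 1)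
    (hf : ∀ t ≥ (0:ℝ), HasDerivAt f (b t * cos (f t) - a t * sin (f t)) t)
    (hg : ∀ t ≥ (0:ℝ), HasDerivAt g (b t * cos (g t) - a t * sin (g t)) t)
    {t : ℝ} (ht : 0 ≤ t) : |f t - g t| ≤ |f 0 - g 0| * exp (2 * t) := by
  have h1 := exp_compare (T := 0) (a := 4) (c := 0) (f := fun t => (f t - g t)^2)
    (f' := fun t => 2 * (f t - g t) * ((b t * cos (f t) - a t * sin (f t)) -
      (b t * cos (g t) - a t * sin (g t))))
    (fun t ht => (((hf t ht).sub (hg t ht)).pow 2).congr_deriv (by simp))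
    (fun t ht => by
      have h1 : |cos (f t) - cos (g t)| ≤ |f t - g t| := abs_cos_sub_cos_le (f t) (g t)
      have h2 : |sin (f t) - sin (g t)| ≤ |f t - g t| := abs_sin_sub_sin_le (f t) (g t)
      have h3 := mul_le_mul (hb t ht) h1 (abs_nonneg _) zero_le_one
      have h4 := mul_le_mul (ha t ht) h2 (abs_nonneg _) zero_le_one
      rw [← abs_mul, one_mul] at h3 h4
      have h5 : |(b t * cos (f t) - a t * sin (f t)) -
        (b t * cos (g t) - a t * sin (g t))| ≤ 2 * |f t - g t| := by
        rw [show (b t * cos (f t) - a t * sin (f t)) - (b t * cos (g t) - a t * sin (g t))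
          = b t * (cos (f t) - cos (g t)) - a t * (sin (f t) - sin (g t)) by ring]
        exact (abs_sub _ _).trans (by linarith)
      have h6 := mul_le_mul_of_nonneg_left h5 (abs_nonneg (f t - g t))
      rw [← abs_mul] at h6
      have h7 := le_abs_self ((f t - g t) * ((b t * cos (f t) - a t * sin (f t)) -
        (b t * cos (g t) - a t * sin (g t))))
      have h8 := abs_mul_abs_self (f t - g t)
      nlinarith) le_rfl ht
  simp only [sub_zero] at h1
  rw [show (4:ℝ) * t = 2 * t + 2 * t by ring, exp_add] at h1
  apply abs_le_of_sq_le_sq' _ (by positivity) |> abs_le.2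
  rw [mul_pow, sq_abs]
  linarith

end KK
namespace KK

set_option linter.unusedSectionVars false

/-- the sine component of the phase relative to the order parameter -/
noncomputable def S (a b x : ℝ) : ℝ := a * sin x - b * cos x
/-- the cosine component of the phase relative to the order parameter -/
noncomputable def C (a b x : ℝ) : ℝ := a * cos x + b * sin x

lemma S_sq_add (a b x : ℝ) : S a b x ^ 2 + C a b x ^ 2 = a ^ 2 + b ^ 2 := by
  unfold S C
  have := sin_sq_add_cos_sq x
  linear_combination (a ^ 2 + b ^ 2) * this

/-- real form of the system -/
structure KS (ρ : Measure ℝ) (Θ : ℝ → ℝ → ℝ) (a b : ℝ → ℝ) : Prop where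
  cont : ∀ t ≥ 0, Continuous (Θ t)
  ha : ∀ t ≥ 0, a t = ∫ θ, cos (Θ t θ) ∂ρ
  hb : ∀ t ≥ 0, b t = ∫ θ, sin (Θ t θ) ∂ρ
  sq : ∀ t ≥ 0, a t ^ 2 + b t ^ 2 ≤ 1
  init : ∀ θ, Θ 0 θ = θ
  ode : ∀ θ, ∀ t ≥ 0, HasDerivAt (fun s => Θ s θ) (- S (a t) (b t) (Θ t θ)) t
  per : ∀ t ≥ 0, ∀ θ, Θ t (θ + 2 * π) = Θ t θ + 2 * π

variable {ρ : Measure ℝ} [IsProbabilityMeasure ρ] {Θ : ℝ → ℝ → ℝ} {a b : ℝ → ℝ}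

lemma intg {f : ℝ → ℝ} (hf : Continuous f) (M : ℝ) (hM : ∀ x, |f x| ≤ M) : Integrable f ρ :=
  Integrable.of_bound hf.aestronglyMeasurable M (ae_of_all _ hM)

lemma int_le_const {f : ℝ → ℝ} {M : ℝ} (hM : ∀ x, |f x| ≤ M) : |∫ x, f x ∂ρ| ≤ M := by
  have := norm_integral_le_of_norm_le_const (μ := ρ) (f := f) (ae_of_all _ hM)
  simpa using this

lemma KS.absS (h : KS ρ Θ a b) {t : ℝ} (ht : 0 ≤ t) (x : ℝ) : |S (a t) (b t) x| ≤ 1 := by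
  rw [← sq_le_one_iff_abs_le_one]
  nlinarith [S_sq_add (a t) (b t) x, h.sq t ht, sq_nonneg (C (a t) (b t) x)]

lemma KS.absC (h : KS ρ Θ a b) {t : ℝ} (ht : 0 ≤ t) (x : ℝ) : |C (a t) (b t) x| ≤ 1 := by
  rw [← sq_le_one_iff_abs_le_one]
  nlinarith [S_sq_add (a t) (b t) x, h.sq t ht, sq_nonneg (S (a t) (b t) x)]

lemma KS.contS (h : KS ρ Θ a b) {t : ℝ} (ht : 0 ≤ t) :
    Continuous (fun θ => S (a t) (b t) (Θ t θ)) := by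
  have := h.cont t ht
  unfold S; fun_prop

lemma KS.contC (h : KS ρ Θ a b) {t : ℝ} (ht : 0 ≤ t) :
    Continuous (fun θ => C (a t) (b t) (Θ t θ)) := by
  have := h.cont t ht
  unfold C; fun_prop

/-- derivative of a -/
noncomputable def p (ρ : Measure ℝ) (Θ : ℝ → ℝ → ℝ) (a b : ℝ → ℝ) (t : ℝ) : ℝ :=
  ∫ θ, sin (Θ t θ) * S (a t) (b t) (Θ t θ) ∂ρ
/-- derivative of b -/
noncomputable def q (ρ : Measure ℝ) (Θ : ℝ → ℝ → ℝ) (a b : ℝ → ℝ) (t : ℝ) : ℝ :=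
  ∫ θ, -(cos (Θ t θ) * S (a t) (b t) (Θ t θ)) ∂ρ
/-- dissipation -/
noncomputable def E (ρ : Measure ℝ) (Θ : ℝ → ℝ → ℝ) (a b : ℝ → ℝ) (t : ℝ) : ℝ :=
  ∫ θ, S (a t) (b t) (Θ t θ) ^ 2 ∂ρ

lemma abs_mul_le_one {x y : ℝ} (hx : |x| ≤ 1) (hy : |y| ≤ 1) : |x * y| ≤ 1 := by
  rw [abs_mul]; exact mul_le_one₀ hx (abs_nonneg _) hy

lemma KS.deriv_a (h : KS ρ Θ a b) {t : ℝ} (ht : 0 < t) : HasDerivAt a (p ρ Θ a b t) t := by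
  have hs : Set.Ioi (0:ℝ) ∈ nhds t := Ioi_mem_nhds ht
  have := (hasDerivAt_integral_of_dominated_loc_of_deriv_le (μ := ρ) (bound := fun _ => (1:ℝ))
    (F := fun t θ => cos (Θ t θ)) (F' := fun t θ => sin (Θ t θ) * S (a t) (b t) (Θ t θ)) hs
    (by filter_upwards [hs] with x hx
        have := h.cont x (le_of_lt hx)
        exact (by fun_prop : Continuous fun θ => cos (Θ x θ)).aestronglyMeasurable)
    (intg (continuous_cos.comp (h.cont t ht.le)) 1 (fun x => abs_cos_le_one _))
    ((continuous_sin.comp (h.cont t ht.le)).mul (h.contS ht.le)).aestronglyMeasurable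
    (ae_of_all _ fun θ x hx => abs_mul_le_one (abs_sin_le_one _) (h.absS (le_of_lt hx) _))
    (integrable_const _)
    (ae_of_all _ fun θ x hx => by
      have := (h.ode θ x (le_of_lt hx)).cos
      refine this.congr_deriv (by ring))).2
  refine this.congr_of_eventuallyEq ?_
  filter_upwards [hs] with x hx
  exact h.ha x (le_of_lt hx)

lemma KS.deriv_b (h : KS ρ Θ a b) {t : ℝ} (ht : 0 < t) : HasDerivAt b (q ρ Θ a b t) t := by
  have hs : Set.Ioi (0:ℝ) ∈ nhds t := Ioi_mem_nhds ht
  have := (hasDerivAt_integral_of_dominated_loc_of_deriv_le (μ := ρ) (bound := fun _ => (1:ℝ))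
    (F := fun t θ => sin (Θ t θ)) (F' := fun t θ => -(cos (Θ t θ) * S (a t) (b t) (Θ t θ))) hs
    (by filter_upwards [hs] with x hx
        have := h.cont x (le_of_lt hx)
        exact (by fun_prop : Continuous fun θ => sin (Θ x θ)).aestronglyMeasurable)
    (intg (continuous_sin.comp (h.cont t ht.le)) 1 (fun x => abs_sin_le_one _))
    ((continuous_cos.comp (h.cont t ht.le)).mul (h.contS ht.le)).neg.aestronglyMeasurable
    (ae_of_all _ fun θ x hx => by
      rw [norm_neg]
      exact abs_mul_le_one (abs_cos_le_one _) (h.absS (le_of_lt hx) _))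
    (integrable_const _)
    (ae_of_all _ fun θ x hx => by
      have := (h.ode θ x (le_of_lt hx)).sin
      refine this.congr_deriv (by ring))).2
  refine this.congr_of_eventuallyEq ?_
  filter_upwards [hs] with x hx
  exact h.hb x (le_of_lt hx)

lemma KS.abs_p (h : KS ρ Θ a b) {t : ℝ} (ht : 0 ≤ t) : |p ρ Θ a b t| ≤ 1 :=
  int_le_const fun _ => abs_mul_le_one (abs_sin_le_one _) (h.absS ht _)
lemma KS.abs_q (h : KS ρ Θ a b) {t : ℝ} (ht : 0 ≤ t) : |q ρ Θ a b t| ≤ 1 :=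
  int_le_const fun _ => by rw [abs_neg]; exact abs_mul_le_one (abs_cos_le_one _) (h.absS ht _)

lemma sq_int_le {f : ℝ → ℝ} (hf : Continuous f) (h1 : ∀ x, |f x| ≤ 1) :
    (∫ x, f x ∂ρ) ^ 2 ≤ ∫ x, f x ^ 2 ∂ρ := by
  set m := ∫ x, f x ∂ρ with hm
  have i1 : Integrable f ρ := intg hf 1 h1
  have i2 : Integrable (fun x => f x ^ 2) ρ := intg (hf.pow 2) 1 (fun x => by
    rw [abs_pow]; exact pow_le_one₀ (abs_nonneg _) (h1 x))
  have h0 : 0 ≤ ∫ x, (f x - m) ^ 2 ∂ρ := integral_nonneg fun x => sq_nonneg _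
  have e : ∫ x, (f x - m) ^ 2 ∂ρ = (∫ x, f x ^ 2 ∂ρ) - 2 * m * m + m ^ 2 := by
    have : ∀ x, (f x - m) ^ 2 = (f x ^ 2 - 2 * m * f x) + m ^ 2 := fun x => by ring
    simp_rw [this]
    rw [integral_add (f := fun x => f x ^ 2 - 2 * m * f x) (i2.sub (i1.const_mul _)) (integrable_const _),
      integral_sub i2 (i1.const_mul _), integral_const_mul]
    simp [hm]
  nlinarith

lemma KS.intSsq (h : KS ρ Θ a b) {t : ℝ} (ht : 0 ≤ t) :
    Integrable (fun θ => S (a t) (b t) (Θ t θ) ^ 2) ρ :=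
  intg ((h.contS ht).pow 2) 1 (fun x => by
    rw [abs_pow]; exact pow_le_one₀ (abs_nonneg _) (h.absS ht _))

lemma KS.p_sq_le (h : KS ρ Θ a b) {t : ℝ} (ht : 0 ≤ t) : p ρ Θ a b t ^ 2 ≤ E ρ Θ a b t := by
  have hc := ((continuous_sin.comp (h.cont t ht)).mul (h.contS ht))
  refine (sq_int_le hc (fun x => abs_mul_le_one (abs_sin_le_one _) (h.absS ht _))).trans ?_
  refine integral_mono (intg (hc.pow 2) 1 fun x => ?_) (h.intSsq ht) fun x => ?_
  · rw [abs_pow]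
    exact pow_le_one₀ (abs_nonneg _) (abs_mul_le_one (abs_sin_le_one _) (h.absS ht _))
  · simp only [Function.comp, mul_pow, Pi.mul_apply]
    exact mul_le_of_le_one_left (sq_nonneg _) (sin_sq_le_one _)

lemma KS.q_sq_le (h : KS ρ Θ a b) {t : ℝ} (ht : 0 ≤ t) : q ρ Θ a b t ^ 2 ≤ E ρ Θ a b t := by
  have hc := ((continuous_cos.comp (h.cont t ht)).mul (h.contS ht)).neg
  refine (sq_int_le hc (fun x => by
    rw [Pi.neg_apply, abs_neg]; exact abs_mul_le_one (abs_cos_le_one _) (h.absS ht _))).trans ?_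
  refine integral_mono (intg (hc.pow 2) 1 fun x => ?_) (h.intSsq ht) fun x => ?_
  · rw [abs_pow, Pi.neg_apply, abs_neg]
    exact pow_le_one₀ (abs_nonneg _) (abs_mul_le_one (abs_cos_le_one _) (h.absS ht _))
  · simp only [Function.comp, mul_pow, Pi.neg_apply, Pi.mul_apply, neg_sq]
    exact mul_le_of_le_one_left (sq_nonneg _) (cos_sq_le_one _)

lemma KS.energy (h : KS ρ Θ a b) {t : ℝ} (ht : 0 ≤ t) :
    a t * p ρ Θ a b t + b t * q ρ Θ a b t = E ρ Θ a b t := by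
  unfold p q E
  rw [← integral_const_mul, ← integral_const_mul, ← integral_add]
  · congr 1; ext θ
    simp only [S]; ring
  · exact (intg (((continuous_sin.comp (h.cont t ht)).mul (h.contS ht))) 1
      fun x => abs_mul_le_one (abs_sin_le_one _) (h.absS ht _)).const_mul _
  · exact (intg (((continuous_cos.comp (h.cont t ht)).mul (h.contS ht)).neg) 1
      fun x => by
        rw [Pi.neg_apply, abs_neg]; exact abs_mul_le_one (abs_cos_le_one _) (h.absS ht _)).const_mul _

lemma KS.deriv_N (h : KS ρ Θ a b) {t : ℝ} (ht : 0 < t) :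
    HasDerivAt (fun t => a t ^ 2 + b t ^ 2) (2 * E ρ Θ a b t) t := by
  refine (((h.deriv_a ht).pow 2).add ((h.deriv_b ht).pow 2)).congr_deriv ?_
  rw [← h.energy ht.le]
  simp; ring

lemma KS.deriv_S (h : KS ρ Θ a b) (θ : ℝ) {t : ℝ} (ht : 0 < t) :
    HasDerivAt (fun t => S (a t) (b t) (Θ t θ))
      (p ρ Θ a b t * sin (Θ t θ) - q ρ Θ a b t * cos (Θ t θ)
        - S (a t) (b t) (Θ t θ) * C (a t) (b t) (Θ t θ)) t := by
  refine (((h.deriv_a ht).mul (h.ode θ t ht.le).sin).sub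
    ((h.deriv_b ht).mul (h.ode θ t ht.le).cos)).congr_deriv ?_
  simp only [C]; ring

lemma KS.deriv_C (h : KS ρ Θ a b) (θ : ℝ) {t : ℝ} (ht : 0 < t) :
    HasDerivAt (fun t => C (a t) (b t) (Θ t θ))
      (p ρ Θ a b t * cos (Θ t θ) + q ρ Θ a b t * sin (Θ t θ)
        + S (a t) (b t) (Θ t θ) ^ 2) t := by
  refine (((h.deriv_a ht).mul (h.ode θ t ht.le).cos).add
    ((h.deriv_b ht).mul (h.ode θ t ht.le).sin)).congr_deriv ?_
  simp only [S]; ring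

lemma KS.E_nonneg (ρ : Measure ℝ) (Θ : ℝ → ℝ → ℝ) (a b : ℝ → ℝ) (t : ℝ) : 0 ≤ E ρ Θ a b t :=
  integral_nonneg fun _ => sq_nonneg _

lemma KS.E_tendsto (h : KS ρ Θ a b) : Tendsto (E ρ Θ a b) atTop (nhds 0) := by
  have := barbalat (F := fun t => a t ^ 2 + b t ^ 2) (E := fun t => 2 * E ρ Θ a b t) (T := 1)
    (L := 12) (M := 1) (by norm_num) (fun t ht => h.deriv_N (by linarith))
    (fun t _ => mul_nonneg zero_le_two (KS.E_nonneg _ _ _ _ t))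
    (fun t ht => h.sq t (by linarith)) (fun s hs t ht => ?_)
  · have h2 := this.const_mul (1/2)
    rw [mul_zero] at h2
    exact h2.congr (fun x => by ring)
  have pt : ∀ θ, S (a s) (b s) (Θ s θ) ^ 2 - 6 * (t - s) ≤ S (a t) (b t) (Θ t θ) ^ 2 := by
    intro θ
    have := mono_Ici (T := 1) (fun t ht => ((h.deriv_S θ (t := t) (by linarith)).pow 2).add
      ((hasDerivAt_id t).const_mul 6)) (fun t ht => by
        have h0 : 0 ≤ t := by linarith
        have b1 := abs_mul_le_one (h.absS h0 (Θ t θ)) (abs_mul_le_one (h.abs_p h0) (abs_sin_le_one (Θ t θ)))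
        have b2 := abs_mul_le_one (h.absS h0 (Θ t θ)) (abs_mul_le_one (h.abs_q h0) (abs_cos_le_one (Θ t θ)))
        have b3 := abs_mul_le_one (h.absS h0 (Θ t θ)) (abs_mul_le_one (h.absS h0 (Θ t θ)) (h.absC h0 (Θ t θ)))
        rw [abs_le] at b1 b2 b3
        norm_num
        nlinarith) hs ht
    simp at this
    linarith
  have := integral_mono (μ := ρ) (f := fun θ => S (a s) (b s) (Θ s θ) ^ 2 - 6 * (t-s)) ((h.intSsq (t := s) (by linarith)).sub (integrable_const (6 * (t-s))))
    (h.intSsq (t := t) (by linarith)) pt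
  rw [integral_sub (h.intSsq (t := s) (by linarith)) (integrable_const _)] at this
  simp at this
  unfold E
  linarith

/-- error term -/
noncomputable def err (ρ : Measure ℝ) (Θ : ℝ → ℝ → ℝ) (a b : ℝ → ℝ) (t : ℝ) : ℝ := 2 * √(E ρ Θ a b t)

lemma KS.err_tendsto (h : KS ρ Θ a b) : Tendsto (err ρ Θ a b) atTop (nhds 0) := by
  have := h.E_tendsto.sqrt.const_mul 2
  simp only [sqrt_zero, mul_zero] at this
  exact this

lemma KS.abs_pq (h : KS ρ Θ a b) {t : ℝ} (ht : 0 ≤ t) {x y : ℝ} (hx : |x| ≤ 1) (hy : |y| ≤ 1) :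
    |p ρ Θ a b t * x + q ρ Θ a b t * y| ≤ err ρ Θ a b t := by
  have h1 : |p ρ Θ a b t| ≤ √(E ρ Θ a b t) := abs_le_sqrt (h.p_sq_le ht)
  have h2 : |q ρ Θ a b t| ≤ √(E ρ Θ a b t) := abs_le_sqrt (h.q_sq_le ht)
  refine (abs_add_le _ _).trans ?_
  rw [abs_mul, abs_mul, err, two_mul]
  exact add_le_add ((mul_le_of_le_one_right (abs_nonneg _) hx).trans h1)
    ((mul_le_of_le_one_right (abs_nonneg _) hy).trans h2)

end KK
namespace KK

set_option linter.unusedSectionVars false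
variable {ρ : Measure ℝ} [IsProbabilityMeasure ρ] {Θ : ℝ → ℝ → ℝ} {a b : ℝ → ℝ}

lemma KS.N_mono (h : KS ρ Θ a b) {s t : ℝ} (hs : 0 < s) (hst : s ≤ t) :
    a s ^ 2 + b s ^ 2 ≤ a t ^ 2 + b t ^ 2 :=
  mono_Ici (T := s) (fun t ht => h.deriv_N (lt_of_lt_of_le hs ht))
    (fun t _ => mul_nonneg zero_le_two (KS.E_nonneg _ _ _ _ t)) le_rfl hst

lemma KS.barrier (h : KS ρ Θ a b) {T N c : ℝ} (hT : 0 < T) (hN0 : 0 < N)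
    (hN : ∀ t ≥ T, N ≤ a t ^ 2 + b t ^ 2)
    (he : ∀ t ≥ T, err ρ Θ a b t < N / 2) (hc : c ^ 2 ≤ N / 4) (θ : ℝ) {s t : ℝ} (hs : T ≤ s)
    (hst : s ≤ t) (h0 : c ≤ C (a s) (b s) (Θ s θ)) : c ≤ C (a t) (b t) (Θ t θ) := by
  have := image_le_of_deriv_right_lt_deriv_boundary (a := s) (b := t)
    (f := fun t => - C (a t) (b t) (Θ t θ)) (B := fun _ => -c) (B' := fun _ => 0)
    (f' := fun t => -(p ρ Θ a b t * cos (Θ t θ) + q ρ Θ a b t * sin (Θ t θ)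
        + S (a t) (b t) (Θ t θ) ^ 2))
    (fun x hx => (h.deriv_C θ (t := x) (by linarith [hx.1])).neg.continuousAt.continuousWithinAt)
    (fun x hx => (h.deriv_C θ (t := x) (by linarith [hx.1])).neg.hasDerivWithinAt)
    (by linarith) (fun x => hasDerivAt_const _ _) (fun x hx hx2 => by
      have hxT : T ≤ x := hs.trans hx.1
      have h1 := h.abs_pq (t := x) (by linarith) (abs_cos_le_one (Θ x θ)) (abs_sin_le_one (Θ x θ))
      have h2 := S_sq_add (a x) (b x) (Θ x θ)
      have h3 := hN x hxT
      have h4 := he x hxT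
      have h5 : C (a x) (b x) (Θ x θ) = c := by linarith
      rw [h5] at h2
      have h6 := (abs_le.1 h1).1
      linarith) (Set.right_mem_Icc.2 hst)
  linarith

lemma exists_angle (a b x : ℝ) : ∃ y ∈ Set.Icc x (x + 2 * π), C a b y = - √(a ^ 2 + b ^ 2) := by
  set w : ℂ := ⟨-a, -b⟩ with hwdef
  have hw : ‖w‖ = √(a ^ 2 + b ^ 2) := by
    rw [Complex.norm_def, Complex.normSq_apply]; simp only [w]; congr 1; ring
  refine ⟨toIcoMod two_pi_pos x w.arg, Set.Ico_subset_Icc_self (toIcoMod_mem_Ico _ _ _), ?_⟩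
  have e : C a b (toIcoMod two_pi_pos x w.arg) = C a b w.arg := by
    rw [toIcoMod, C, C, zsmul_eq_mul, cos_sub_int_mul_two_pi, sin_sub_int_mul_two_pi]
  rw [e, ← hw]
  have h1 : ‖w‖ * cos w.arg = -a := Complex.norm_mul_cos_arg w
  have h2 : ‖w‖ * sin w.arg = -b := Complex.norm_mul_sin_arg w
  have h4 : a = -(‖w‖ * cos w.arg) := by linarith
  have h5 : b = -(‖w‖ * sin w.arg) := by linarith
  have h3 := sin_sq_add_cos_sq w.arg
  unfold C
  clear_value w
  rw [h4, h5]
  linear_combination (-‖w‖) * h3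

lemma KS.exists_alpha (h : KS ρ Θ a b) {t1 : ℝ} (ht1 : 0 < t1) (hpos : 0 < a t1 ^ 2 + b t1 ^ 2) :
    ∃ κ > 0, ∃ T > 0, ∃ α, ∀ t ≥ T, C (a t) (b t) (Θ t α) ≤ -κ := by
  set N := a t1 ^ 2 + b t1 ^ 2
  obtain ⟨T1, hT1⟩ := eventually_atTop.1 (h.err_tendsto.eventually_lt_const (half_pos hpos))
  set T := max t1 T1
  have hT : 0 < T := lt_of_lt_of_le ht1 (le_max_left _ _)
  have hN : ∀ t ≥ T, N ≤ a t ^ 2 + b t ^ 2 := fun t ht =>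
    h.N_mono ht1 ((le_max_left _ _).trans ht)
  have he : ∀ t ≥ T, err ρ Θ a b t < N / 2 := fun t ht => hT1 t ((le_max_right _ _).trans ht)
  set κ := √N / 2
  have hκ : 0 < κ := by positivity
  have hκ2 : κ ^ 2 = N / 4 := by
    simp only [κ]; rw [div_pow, sq_sqrt hpos.le]; norm_num
  have nest : ∀ s t θ, T ≤ s → s ≤ t → C (a t) (b t) (Θ t θ) ≤ -κ →
      C (a s) (b s) (Θ s θ) ≤ -κ := by
    intro s t θ hs hst h1
    by_contra h2
    push Not at h2
    set c := min (C (a s) (b s) (Θ s θ)) 0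
    have hc1 : -κ < c := lt_min h2 (by linarith)
    have hc2 : c ≤ 0 := min_le_right _ _
    have := h.barrier hT hpos hN he (c := c) (by nlinarith) θ hs hst (min_le_left _ _)
    linarith
  have := IsCompact.nonempty_iInter_of_sequence_nonempty_isCompact_isClosed
    (fun n : ℕ => Set.Icc 0 (2 * π) ∩ {θ | C (a (T + n)) (b (T + n)) (Θ (T + n) θ) ≤ -κ})
    (fun n => by
      rintro θ ⟨h1, h2⟩
      refine ⟨h1, nest _ _ θ (by simp) ?_ h2⟩
      push_cast; linarith)
    (fun n => by
      set t := T + (n:ℝ)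
      have ht : T ≤ t := by simp [t]
      have ht0 : 0 ≤ t := by linarith
      obtain ⟨y, hy, hy2⟩ := exists_angle (a t) (b t) (Θ t 0)
      have hp := h.per t ht0 0
      rw [← hp, zero_add] at hy
      obtain ⟨θ, hθ, hθ2⟩ := intermediate_value_Icc (a := 0) (b := 2 * π) (by positivity)
        (h.cont t ht0).continuousOn hy
      refine ⟨θ, hθ, ?_⟩
      simp only [Set.mem_ofPred_eq]
      rw [hθ2, hy2, neg_le_neg_iff]
      have := sqrt_le_sqrt (hN t ht)
      have h0 := sqrt_nonneg N
      simp only [κ]; linarith)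
    (isCompact_Icc.inter_right (isClosed_le (h.contC (by simp; linarith)) continuous_const))
    (fun n => isClosed_Icc.inter (isClosed_le (h.contC (by positivity)) continuous_const))
  obtain ⟨α, hα⟩ := this
  rw [Set.mem_iInter] at hα
  refine ⟨κ, hκ, T, hT, α, fun t ht => ?_⟩
  obtain ⟨n, hn⟩ := exists_nat_ge (t - T)
  exact nest t (T + n) α ht (by linarith) (hα n).2

lemma KS.S_tendsto (h : KS ρ Θ a b) {κ T α : ℝ} (hκ : 0 < κ) (hT : 0 < T)
    (hα : ∀ t ≥ T, C (a t) (b t) (Θ t α) ≤ -κ) :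
    Tendsto (fun t => S (a t) (b t) (Θ t α) ^ 2) atTop (nhds 0) := by
  refine unstable (T := T) (a := 2 * κ) (M := 1) (δ := fun t => 2 * err ρ Θ a b t) (by positivity)
    (fun t ht => (h.deriv_S α (t := t) (by linarith)).pow 2) (fun t _ => sq_nonneg _)
    (fun t ht => by
      rw [sq_le_one_iff_abs_le_one]; exact h.absS (by linarith) _) (fun t ht => ?_)
    (by simpa using h.err_tendsto.const_mul 2)
  have ht0 : 0 ≤ t := by linarith
  have h1 := h.abs_pq ht0 (x := sin (Θ t α)) (y := - cos (Θ t α)) (abs_sin_le_one _)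
    (by rw [abs_neg]; exact abs_cos_le_one _)
  have h2 := h.absS ht0 (Θ t α)
  have h3 := mul_le_mul h2 h1 (abs_nonneg _) zero_le_one
  rw [← abs_mul, one_mul] at h3
  have h4 := (abs_le.1 h3).1
  have h5 := mul_le_mul_of_nonneg_left (hα t ht) (sq_nonneg (S (a t) (b t) (Θ t α)))
  norm_num
  nlinarith

end KK
namespace KK

set_option linter.unusedSectionVars false
variable {ρ : Measure ℝ} [IsProbabilityMeasure ρ] {Θ : ℝ → ℝ → ℝ} {a b : ℝ → ℝ}

/-- relative phase -/
def D (Θ : ℝ → ℝ → ℝ) (α t θ : ℝ) : ℝ := Θ t θ - Θ t α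
/-- sine of the half relative phase -/
noncomputable def Y (Θ : ℝ → ℝ → ℝ) (α t θ : ℝ) : ℝ := sin (D Θ α t θ / 2)
/-- cosine of the half relative phase -/
noncomputable def Z (Θ : ℝ → ℝ → ℝ) (α t θ : ℝ) : ℝ := cos (D Θ α t θ / 2)
/-- cotangent of the half relative phase -/
noncomputable def U (Θ : ℝ → ℝ → ℝ) (α t θ : ℝ) : ℝ := Z Θ α t θ / Y Θ α t θ

lemma YZ (Θ : ℝ → ℝ → ℝ) (α t θ : ℝ) : Y Θ α t θ ^ 2 + Z Θ α t θ ^ 2 = 1 := sin_sq_add_cos_sq _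

lemma cosD (Θ : ℝ → ℝ → ℝ) (α t θ : ℝ) : cos (D Θ α t θ) = 1 - 2 * Y Θ α t θ ^ 2 := by
  have h1 := cos_two_mul (D Θ α t θ / 2)
  rw [show 2 * (D Θ α t θ / 2) = D Θ α t θ by ring] at h1
  have := YZ Θ α t θ
  unfold Y Z at *
  linarith

lemma sinD (Θ : ℝ → ℝ → ℝ) (α t θ : ℝ) :
    sin (D Θ α t θ) = 2 * Y Θ α t θ * Z Θ α t θ := by
  have h1 := sin_two_mul (D Θ α t θ / 2)
  rwa [show 2 * (D Θ α t θ / 2) = D Θ α t θ by ring] at h1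

lemma KS.deriv_D (h : KS ρ Θ a b) (α θ : ℝ) {t : ℝ} (ht : 0 ≤ t) :
    HasDerivAt (fun t => D Θ α t θ) (2 * Y Θ α t θ * (S (a t) (b t) (Θ t α) * Y Θ α t θ
      - C (a t) (b t) (Θ t α) * Z Θ α t θ)) t := by
  refine ((h.ode θ t ht).sub (h.ode α t ht)).congr_deriv ?_
  have e : Θ t θ = Θ t α + D Θ α t θ := by unfold D; ring
  have h1 := cosD Θ α t θ
  have h2 := sinD Θ α t θ
  unfold S C
  nth_rw 1 2 [e]
  rw [cos_add, sin_add, h1, h2]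
  ring

lemma KS.deriv_Y (h : KS ρ Θ a b) (α θ : ℝ) {t : ℝ} (ht : 0 ≤ t) :
    HasDerivAt (fun t => Y Θ α t θ) (Z Θ α t θ * (S (a t) (b t) (Θ t α) * Y Θ α t θ
      - C (a t) (b t) (Θ t α) * Z Θ α t θ) * Y Θ α t θ) t := by
  refine ((h.deriv_D α θ ht).div_const 2).sin.congr_deriv ?_
  unfold Z; ring

lemma KS.deriv_Z (h : KS ρ Θ a b) (α θ : ℝ) {t : ℝ} (ht : 0 ≤ t) :
    HasDerivAt (fun t => Z Θ α t θ) (- Y Θ α t θ * (S (a t) (b t) (Θ t α) * Y Θ α t θ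
      - C (a t) (b t) (Θ t α) * Z Θ α t θ) * Y Θ α t θ) t := by
  refine ((h.deriv_D α θ ht).div_const 2).cos.congr_deriv ?_
  unfold Y; ring

lemma KS.deriv_U (h : KS ρ Θ a b) (α θ : ℝ) {t : ℝ} (ht : 0 ≤ t) (hy : Y Θ α t θ ≠ 0) :
    HasDerivAt (fun t => U Θ α t θ) (C (a t) (b t) (Θ t α) * U Θ α t θ
      - S (a t) (b t) (Θ t α)) t := by
  refine ((h.deriv_Z α θ ht).div (h.deriv_Y α θ ht) hy).congr_deriv ?_
  have := YZ Θ α t θ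
  unfold U
  field_simp
  linear_combination ((C (a t) (b t) (Θ t α) * Z Θ α t θ - S (a t) (b t) (Θ t α) * Y Θ α t θ)) * this

lemma KS.Y_bound (h : KS ρ Θ a b) (α θ : ℝ) {t : ℝ} (ht : 0 ≤ t) :
    |Z Θ α t θ * (S (a t) (b t) (Θ t α) * Y Θ α t θ
      - C (a t) (b t) (Θ t α) * Z Θ α t θ)| ≤ 2 := by
  have hZ : |Z Θ α t θ| ≤ 1 := abs_cos_le_one _
  have hY : |Y Θ α t θ| ≤ 1 := abs_sin_le_one _
  have h1 := abs_mul_le_one hZ (abs_mul_le_one (h.absS ht (Θ t α)) hY)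
  have h2 := abs_mul_le_one hZ (abs_mul_le_one (h.absC ht (Θ t α)) hZ)
  rw [mul_sub]
  exact (abs_sub _ _).trans (by linarith)

lemma KS.Y_zero (h : KS ρ Θ a b) (α θ : ℝ) {t : ℝ} (ht : 0 ≤ t) (h0 : Y Θ α 0 θ = 0) :
    Y Θ α t θ = 0 := by
  have := exp_compare (T := 0) (a := 4) (c := 0) (fun t ht => (h.deriv_Y α θ ht).pow 2)
    (fun t ht => by
      have := (abs_le.1 (h.Y_bound α θ ht)).2
      have := mul_le_mul_of_nonneg_left this (sq_nonneg (Y Θ α t θ))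
      norm_num
      nlinarith) le_rfl ht
  simp [h0] at this
  exact this

lemma KS.Y_ne_zero (h : KS ρ Θ a b) (α θ : ℝ) {t : ℝ} (ht : 0 ≤ t) (h0 : Y Θ α 0 θ ≠ 0) :
    Y Θ α t θ ≠ 0 := by
  have := exp_compare (T := 0) (a := -4) (c := 0) (fun t ht => ((h.deriv_Y α θ ht).pow 2).neg)
    (fun t ht => by
      have := (abs_le.1 (h.Y_bound α θ ht)).1
      have := mul_le_mul_of_nonneg_left this (sq_nonneg (Y Θ α t θ))
      norm_num
      nlinarith) le_rfl ht
  intro h1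
  simp [h1] at this
  have h2 : 0 < Y Θ α 0 θ ^ 2 * exp (-(4 * t)) := by positivity
  linarith

lemma KS.U_tendsto (h : KS ρ Θ a b) {κ T α : ℝ} (hκ : 0 < κ) (hT : 0 < T)
    (hα : ∀ t ≥ T, C (a t) (b t) (Θ t α) ≤ -κ) {θ : ℝ} (h0 : Y Θ α 0 θ ≠ 0) :
    Tendsto (fun t => U Θ α t θ) atTop (nhds 0) := by
  have : Tendsto (fun t => U Θ α t θ ^ 2) atTop (nhds 0) := by
    refine stable (T := T) (a := κ) (δ := fun t => (1 / κ) * S (a t) (b t) (Θ t α) ^ 2) hκ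
      (fun t ht => (h.deriv_U α θ (t := t) (by linarith)
        (h.Y_ne_zero α θ (by linarith) h0)).pow 2) (fun t _ => sq_nonneg _)
      (fun t ht => ?_) (by simpa using (h.S_tendsto hκ hT hα).const_mul (1 / κ))
    have h1 := mul_le_mul_of_nonneg_left (hα t ht) (sq_nonneg (U Θ α t θ))
    set u := U Θ α t θ
    set s := S (a t) (b t) (Θ t α)
    have h2 : - 2 * u * s ≤ κ * u ^ 2 + (1 / κ) * s ^ 2 := by
      have h3 : κ * u ^ 2 + (1 / κ) * s ^ 2 + 2 * u * s = (1 / κ) * (κ * u + s) ^ 2 := by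
        field_simp; ring
      have h4 : 0 ≤ (1 / κ) * (κ * u + s) ^ 2 := by positivity
      linarith
    norm_num
    norm_num at h2
    nlinarith
  have h2 := this.sqrt
  simp only [sqrt_sq_eq_abs, sqrt_zero] at h2
  exact (tendsto_zero_iff_abs_tendsto_zero _).2 h2

lemma hasDerivAt_abs_lin {f : ℝ → ℝ} {c t : ℝ} (hf : HasDerivAt f (c * f t) t) :
    HasDerivAt (fun s => |f s|) (c * |f t|) t := by
  by_cases h : f t = 0
  · rw [h, mul_zero] at hf
    rw [h, abs_zero, mul_zero]
    rw [hasDerivAt_iff_isLittleO] at hf ⊢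
    simp [h] at hf ⊢
    exact hf
  · rcases lt_or_gt_of_ne h with h1 | h1
    · have := (hasDerivAt_abs_neg h1).comp t hf
      refine this.congr_deriv ?_
      rw [abs_of_neg h1]; ring
    · have := (hasDerivAt_abs_pos h1).comp t hf
      refine this.congr_deriv ?_
      rw [abs_of_pos h1]; ring

open Classical in
/-- the distance of `U` to the reference value -/
noncomputable def X (Θ : ℝ → ℝ → ℝ) (α t θ : ℝ) : ℝ :=
  if Y Θ α 0 θ = 0 then 0 else |U Θ α t θ - U Θ α t (α + π)|

lemma X_nonneg (Θ : ℝ → ℝ → ℝ) (α t θ : ℝ) : 0 ≤ X Θ α t θ := by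
  unfold X; split_ifs
  · exact le_rfl
  · exact abs_nonneg _

lemma KS.Y_ref (h : KS ρ Θ a b) (α : ℝ) : Y Θ α 0 (α + π) ≠ 0 := by
  unfold Y D
  rw [h.init, h.init, add_sub_cancel_left, sin_pi_div_two]
  exact one_ne_zero

lemma KS.deriv_X (h : KS ρ Θ a b) (α θ : ℝ) {t : ℝ} (ht : 0 ≤ t) :
    HasDerivAt (fun t => X Θ α t θ) (C (a t) (b t) (Θ t α) * X Θ α t θ) t := by
  unfold X
  split_ifs with h0
  · simpa using hasDerivAt_const t (0:ℝ)
  · refine hasDerivAt_abs_lin (f := fun t => U Θ α t θ - U Θ α t (α + π)) ?_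
    refine ((h.deriv_U α θ ht (h.Y_ne_zero α θ ht h0)).sub
      (h.deriv_U α _ ht (h.Y_ne_zero α _ ht (h.Y_ref α)))).congr_deriv ?_
    ring

lemma KS.cont_D (h : KS ρ Θ a b) (α : ℝ) {t : ℝ} (ht : 0 ≤ t) : Continuous (D Θ α t) := by
  have := h.cont t ht
  unfold D; fun_prop

lemma KS.meas_U (h : KS ρ Θ a b) (α : ℝ) {t : ℝ} (ht : 0 ≤ t) : Measurable (U Θ α t) := by
  have := (h.cont_D α ht).measurable
  unfold U Y Z
  fun_prop

lemma KS.meas_set (h : KS ρ Θ a b) (α : ℝ) : MeasurableSet {θ | Y Θ α 0 θ = 0} := by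
  have := h.cont_D α le_rfl
  exact (isClosed_eq (by unfold Y; fun_prop) continuous_const).measurableSet

lemma KS.meas_X (h : KS ρ Θ a b) (α : ℝ) {t : ℝ} (ht : 0 ≤ t) : Measurable (X Θ α t) := by
  unfold X
  refine Measurable.ite (h.meas_set α) measurable_const ?_
  have := ((h.meas_U α ht).sub_const (U Θ α t (α + π)))
  exact continuous_abs.measurable.comp this

/-- Lyapunov functional -/
noncomputable def V (ρ : Measure ℝ) (Θ : ℝ → ℝ → ℝ) (α t : ℝ) : ℝ := ∫ θ, arctan (X Θ α t θ) ∂ρ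
/-- its dissipation -/
noncomputable def K (ρ : Measure ℝ) (Θ : ℝ → ℝ → ℝ) (α t : ℝ) : ℝ :=
  ∫ θ, X Θ α t θ / (1 + X Θ α t θ ^ 2) ∂ρ

lemma X_frac (Θ : ℝ → ℝ → ℝ) (α t θ : ℝ) : |X Θ α t θ / (1 + X Θ α t θ ^ 2)| ≤ 1 := by
  have := X_nonneg Θ α t θ
  rw [abs_of_nonneg (by positivity), div_le_one (by positivity)]
  nlinarith [sq_nonneg (X Θ α t θ - 1)]

lemma KS.deriv_V (h : KS ρ Θ a b) (α : ℝ) {t : ℝ} (ht : 0 < t) :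
    HasDerivAt (V ρ Θ α) (C (a t) (b t) (Θ t α) * K ρ Θ α t) t := by
  have hs : Set.Ioi (0:ℝ) ∈ nhds t := Ioi_mem_nhds ht
  have := (hasDerivAt_integral_of_dominated_loc_of_deriv_le (μ := ρ) (bound := fun _ => (1:ℝ))
    (F := fun t θ => arctan (X Θ α t θ))
    (F' := fun t θ => C (a t) (b t) (Θ t α) * (X Θ α t θ / (1 + X Θ α t θ ^ 2))) hs
    (by filter_upwards [hs] with x hx
        exact (measurable_arctan.comp (h.meas_X α (le_of_lt hx))).aestronglyMeasurable)
    (Integrable.of_bound (measurable_arctan.comp (h.meas_X α ht.le)).aestronglyMeasurable (π / 2)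
      (ae_of_all _ fun θ => abs_le.2 ⟨(neg_pi_div_two_lt_arctan _).le, (arctan_lt_pi_div_two _).le⟩))
    (by
      have := h.meas_X α ht.le
      exact (by fun_prop : Measurable fun θ =>
        C (a t) (b t) (Θ t α) * (X Θ α t θ / (1 + X Θ α t θ ^ 2))).aestronglyMeasurable)
    (ae_of_all _ fun θ x hx => abs_mul_le_one (h.absC (le_of_lt hx) _) (X_frac _ _ _ _))
    (integrable_const _)
    (ae_of_all _ fun θ x hx => by
      have := (h.deriv_X α θ (le_of_lt hx)).arctan
      refine this.congr_deriv (by ring))).2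
  unfold K
  rw [← integral_const_mul]
  exact this

lemma V_nonneg (ρ : Measure ℝ) (Θ : ℝ → ℝ → ℝ) (α t : ℝ) : 0 ≤ V ρ Θ α t :=
  integral_nonneg fun θ => arctan_nonneg.2 (X_nonneg Θ α t θ)

/-- forcing of the reference value -/
noncomputable def G (ρ : Measure ℝ) (Θ : ℝ → ℝ → ℝ) (α t : ℝ) : ℝ :=
  ∫ θ, (U Θ α t (α + π) * (cos (D Θ α t θ) - 1) + sin (D Θ α t θ)) ∂ρ

lemma KS.int_cosD (h : KS ρ Θ a b) (α : ℝ) {t : ℝ} (ht : 0 ≤ t) :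
    ∫ θ, cos (D Θ α t θ) ∂ρ = C (a t) (b t) (Θ t α) := by
  have hc := h.cont t ht
  unfold D C
  simp_rw [cos_sub]
  rw [integral_add, integral_mul_const, integral_mul_const, h.ha t ht, h.hb t ht]
  · exact (intg (by fun_prop) 1 fun _ => abs_cos_le_one _).mul_const _
  · exact (intg (by fun_prop) 1 fun _ => abs_sin_le_one _).mul_const _

lemma KS.int_sinD (h : KS ρ Θ a b) (α : ℝ) {t : ℝ} (ht : 0 ≤ t) :
    ∫ θ, sin (D Θ α t θ) ∂ρ = - S (a t) (b t) (Θ t α) := by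
  have hc := h.cont t ht
  unfold D S
  simp_rw [sin_sub]
  rw [integral_sub, integral_mul_const, integral_mul_const, h.ha t ht, h.hb t ht]
  · ring
  · exact (intg (by fun_prop) 1 fun _ => abs_sin_le_one _).mul_const _
  · exact (intg (by fun_prop) 1 fun _ => abs_cos_le_one _).mul_const _

lemma KS.G_eq (h : KS ρ Θ a b) (α : ℝ) {t : ℝ} (ht : 0 ≤ t) :
    G ρ Θ α t = U Θ α t (α + π) * (C (a t) (b t) (Θ t α) - 1) - S (a t) (b t) (Θ t α) := by
  have hc := h.cont_D α ht
  have i1 : Integrable (fun θ => cos (D Θ α t θ)) ρ := intg (by fun_prop) 1 fun _ => abs_cos_le_one _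
  have i2 : Integrable (fun θ => sin (D Θ α t θ)) ρ := intg (by fun_prop) 1 fun _ => abs_sin_le_one _
  unfold G
  rw [integral_add (f := fun θ => U Θ α t (α + π) * (cos (D Θ α t θ) - 1)) ((i1.sub (integrable_const 1)).const_mul _) i2, integral_const_mul,
    integral_sub i1 (integrable_const 1), h.int_cosD α ht, h.int_sinD α ht]
  simp; ring

lemma KS.G_le (h : KS ρ Θ a b) (α : ℝ) {t : ℝ} (ht : 0 ≤ t) (hβ : U Θ α t (α + π) ^ 2 ≤ 1 / 2) :
    |G ρ Θ α t| ≤ 4 * K ρ Θ α t := by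
  have hm := h.meas_X α ht
  unfold K G
  rw [← integral_const_mul, ← Real.norm_eq_abs]
  refine norm_integral_le_of_norm_le ?_ (ae_of_all _ fun θ => ?_)
  · exact (Integrable.of_bound (by fun_prop : Measurable fun θ => X Θ α t θ / (1 + X Θ α t θ ^ 2)).aestronglyMeasurable
      1 (ae_of_all _ fun θ => X_frac _ _ _ _)).const_mul 4
  · rw [cosD, sinD, Real.norm_eq_abs]
    by_cases h0 : Y Θ α 0 θ = 0
    · simp [h.Y_zero α θ ht h0, X, h0]
    · have hy := h.Y_ne_zero α θ ht h0
      set β := U Θ α t (α + π)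
      have hX : X Θ α t θ = |U Θ α t θ - β| := by simp [X, h0, β]
      have hYU : Y Θ α t θ ^ 2 = 1 / (1 + U Θ α t θ ^ 2) := by
        have := YZ Θ α t θ
        have hp : 1 + U Θ α t θ ^ 2 ≠ 0 := by positivity
        rw [eq_div_iff hp]
        unfold U
        field_simp
        exact this
      have hZ : Z Θ α t θ = U Θ α t θ * Y Θ α t θ := by unfold U; field_simp
      rw [hX, hZ]
      set u := U Θ α t θ
      have e : β * (1 - 2 * Y Θ α t θ ^ 2 - 1) + 2 * Y Θ α t θ * (u * Y Θ α t θ)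
        = 2 * (u - β) / (1 + u ^ 2) := by
        have : β * (1 - 2 * Y Θ α t θ ^ 2 - 1) + 2 * Y Θ α t θ * (u * Y Θ α t θ) =
          2 * (u - β) * Y Θ α t θ ^ 2 := by ring
        rw [this, hYU]; ring
      rw [e, abs_div, abs_mul, abs_two, abs_of_pos (show 0 < 1 + u ^ 2 by positivity), sq_abs,
        mul_div_assoc', div_le_div_iff₀ (by positivity) (by positivity)]
      have h3 : 1 + (u - β) ^ 2 ≤ 2 * (1 + u ^ 2) := by nlinarith [sq_nonneg (u + β)]
      nlinarith [abs_nonneg (u - β)]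

end KK
namespace KK

set_option linter.unusedSectionVars false
variable {ρ : Measure ℝ} [IsProbabilityMeasure ρ] {Θ : ℝ → ℝ → ℝ} {a b : ℝ → ℝ}

lemma KS.V_tendsto (h : KS ρ Θ a b) {κ T α : ℝ} (hκ : 0 < κ) (hT : 0 < T)
    (hα : ∀ t ≥ T, C (a t) (b t) (Θ t α) ≤ -κ) : Tendsto (V ρ Θ α) atTop (nhds 0) := by
  have := tendsto_integral_filter_of_dominated_convergence (μ := ρ) (l := atTop)
    (F := fun t θ => arctan (X Θ α t θ)) (f := fun _ => 0) (fun _ => π / 2)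
    (by filter_upwards [eventually_ge_atTop 0] with x hx
        exact (measurable_arctan.comp (h.meas_X α hx)).aestronglyMeasurable)
    (Eventually.of_forall fun t => ae_of_all _ fun θ =>
      abs_le.2 ⟨(neg_pi_div_two_lt_arctan _).le, (arctan_lt_pi_div_two _).le⟩)
    (integrable_const _)
    (ae_of_all _ fun θ => by
      have hX : Tendsto (fun t => X Θ α t θ) atTop (nhds 0) := by
        unfold X
        split_ifs with h0
        · exact tendsto_const_nhds
        · have := ((h.U_tendsto hκ hT hα h0).sub (h.U_tendsto hκ hT hα (h.Y_ref α))).abs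
          simpa using this
      have := (continuous_arctan.tendsto 0).comp hX
      rw [arctan_zero] at this
      exact this)
  rw [integral_zero] at this
  exact this

lemma KS.omega_est (h : KS ρ Θ a b) {κ T α : ℝ} (hκ : 0 < κ) (hT : 0 < T)
    (hα : ∀ t ≥ T, C (a t) (b t) (Θ t α) ≤ -κ)
    (hβ : ∀ t ≥ T, U Θ α t (α + π) ^ 2 ≤ 1 / 2) {s t : ℝ} (hs : T ≤ s) (hst : s ≤ t) :
    |Θ t α - Θ s α| ≤ (2 * |U Θ α t (α + π)| - (12 / κ) * V ρ Θ α t) -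
      (2 * |U Θ α s (α + π)| - (12 / κ) * V ρ Θ α s) := by
  have main : ∀ σ : ℝ, |σ| ≤ 1 → ∀ ε > 0, 
      2 * (√(U Θ α s (α + π) ^ 2 + ε ^ 2) + ε * s) - (12 / κ) * V ρ Θ α s + σ * Θ s α ≤ 
      2 * (√(U Θ α t (α + π) ^ 2 + ε ^ 2) + ε * t) - (12 / κ) * V ρ Θ α t + σ * Θ t α := by
    intro σ hσ ε hε
    have hpos : ∀ t, 0 < U Θ α t (α + π) ^ 2 + ε ^ 2 := fun t => by positivity
    refine mono_Ici (T := T)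
      (f := fun t => 2 * (√(U Θ α t (α + π) ^ 2 + ε ^ 2) + ε * t) - (12 / κ) * V ρ Θ α t
        + σ * Θ t α) (fun t ht => 
      ((((((h.deriv_U α (α + π) (t := t) (by linarith)
        (h.Y_ne_zero α _ (by linarith) (h.Y_ref α))).pow 2).add_const (ε ^ 2)).sqrt
        (hpos t).ne').add ((hasDerivAt_id t).const_mul ε)).const_mul 2).sub
        ((h.deriv_V α (by linarith)).const_mul (12 / κ)) |>.add
        ((h.ode α t (by linarith)).const_mul σ)) (fun t ht => ?_) hs hst
    have ht0 : 0 ≤ t := by linarith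
    have hG := h.G_eq α ht0
    have hG2 := h.G_le α ht0 (hβ t ht)
    have hC := hα t ht
    have hC1 := h.absC ht0 (Θ t α)
    have hK : 0 ≤ K ρ Θ α t := by linarith [abs_nonneg (G ρ Θ α t)]
    set β := U Θ α t (α + π)
    set c := C (a t) (b t) (Θ t α)
    set w := S (a t) (b t) (Θ t α)
    set k := K ρ Θ α t
    set g := G ρ Θ α t
    set r := √(β ^ 2 + ε ^ 2) with hr
    have hr0 : 0 < r := sqrt_pos.2 (hpos t)
    have hr2 : r ^ 2 = β ^ 2 + ε ^ 2 := sq_sqrt (hpos t).le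
    have hrβ : |β| ≤ r := abs_le_sqrt (by nlinarith)
    have hrε : ε ≤ r := by
      have : |ε| ≤ r := abs_le_sqrt (by nlinarith)
      exact (le_abs_self _).trans this
    have e1 : c * β - w = β + g := by rw [hG]; ring
    have e2 : (12 / κ) * (c * k) ≤ -12 * k := by
      have : c * k ≤ -κ * k := by gcongr
      calc (12 / κ) * (c * k) ≤ (12 / κ) * (-κ * k) := by gcongr
        _ = -12 * k := by field_simp
    have e3 : r - ε - |g| ≤ β * (β + g) / r := by
      rw [le_div_iff₀ hr0]
      have i1 : -(|g| * r) ≤ β * g := by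
        have := mul_le_mul_of_nonneg_right hrβ (abs_nonneg g)
        have h2 := neg_abs_le (β * g)
        rw [abs_mul] at h2
        linarith
      nlinarith
    have e4 : -(2 * |β| + |g|) ≤ σ * -w := by
      have i1 : w = (c - 1) * β - g := by linarith
      have i2 : |w| ≤ 2 * |β| + |g| := by
        rw [i1]
        refine (abs_sub _ _).trans ?_
        rw [abs_mul]
        have : |c - 1| ≤ 2 := by
          rw [abs_le] at hC1 ⊢
          constructor <;> linarith [hC1.1, hC1.2]
        gcongr
      have i3 : |σ * -w| ≤ |w| := by
        rw [abs_mul, abs_neg]; exact mul_le_of_le_one_left (abs_nonneg _) hσ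
      have := neg_abs_le (σ * -w)
      linarith
    rw [e1]
    have e5 : ((2:ℕ):ℝ) * β ^ (2 - 1) * (β + g) / (2 * r) = β * (β + g) / r := by
      field_simp; norm_num; ring
    change 0 ≤ 2 * (((2:ℕ):ℝ) * β ^ (2 - 1) * (β + g) / (2 * r) + ε * 1) - 12 / κ * (c * k) + σ * -w
    rw [e5]
    linarith
  have fin : ∀ ε > 0, |Θ t α - Θ s α| ≤ (2 * |U Θ α t (α + π)| - (12 / κ) * V ρ Θ α t) -
      (2 * |U Θ α s (α + π)| - (12 / κ) * V ρ Θ α s) + ε * (2 + 2 * (t - s)) := by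
    intro ε hε
    have h1 := main 1 (by simp) ε hε
    have h2 := main (-1) (by simp) ε hε
    have h3 : |U Θ α s (α + π)| ≤ √(U Θ α s (α + π) ^ 2 + ε ^ 2) := abs_le_sqrt (by nlinarith)
    have h4 : √(U Θ α t (α + π) ^ 2 + ε ^ 2) ≤ |U Θ α t (α + π)| + ε := by
      refine sqrt_le_iff.2 ⟨by positivity, ?_⟩
      nlinarith [sq_abs (U Θ α t (α + π)), abs_nonneg (U Θ α t (α + π))]
    rw [abs_le]
    constructor <;> linarith
  refine le_of_forall_pos_le_add fun ε hε => ?_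
  have hp : 0 < 2 + 2 * (t - s) := by linarith
  have := fin (ε / (2 + 2 * (t - s))) (by positivity)
  rwa [div_mul_cancel₀ _ hp.ne'] at this

lemma KS.omega_tendsto (h : KS ρ Θ a b) {κ T α : ℝ} (hκ : 0 < κ) (hT : 0 < T)
    (hα : ∀ t ≥ T, C (a t) (b t) (Θ t α) ≤ -κ) :
    ∃ L, Tendsto (fun t => Θ t α) atTop (nhds L) := by
  have hβ := h.U_tendsto hκ hT hα (h.Y_ref α)
  have hβ2 := hβ.pow 2
  rw [zero_pow two_ne_zero] at hβ2
  obtain ⟨T1, hT1⟩ := eventually_atTop.1 (hβ2.eventually_lt_const (show (0:ℝ) < 1 / 2 by norm_num))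
  set T2 := max T T1
  have est := fun s t => h.omega_est (T := T2) (s := s) (t := t) hκ
    (lt_of_lt_of_le hT (le_max_left _ _))
    (fun t ht => hα t ((le_max_left _ _).trans ht)) (fun t ht => (hT1 t ((le_max_right _ _).trans ht)).le)
  have hQ := (hβ.abs.const_mul 2).sub ((h.V_tendsto hκ hT hα).const_mul (12 / κ))
  simp only [abs_zero, mul_zero, sub_zero] at hQ
  apply cauchySeq_tendsto_of_complete
  rw [Metric.cauchySeq_iff']
  intro ε hε
  rw [Metric.tendsto_atTop] at hQ
  obtain ⟨N, hN⟩ := hQ (ε / 2) (half_pos hε)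
  refine ⟨max T2 N, fun n hn => ?_⟩
  have h1 := est (max T2 N) n (le_max_left _ _) hn
  have h2 := hN n ((le_max_right _ _).trans hn)
  have h3 := hN (max T2 N) (le_max_right _ _)
  rw [Real.dist_eq, sub_zero, abs_lt] at h2 h3
  rw [Real.dist_eq]
  linarith [h2.1, h2.2, h3.1, h3.2]

lemma periodic_bdd {f : ℝ → ℝ} (hf : Continuous f) (hp : Function.Periodic f (2 * π)) :
    ∃ M, ∀ x, |f x| ≤ M := by
  obtain ⟨M, hM⟩ := (isCompact_Icc (a := (0:ℝ)) (b := 2 * π)).exists_bound_of_continuousOn hf.continuousOn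
  refine ⟨M, fun x => ?_⟩
  obtain ⟨y, hy, hy2⟩ := hp.exists_mem_Ico₀ two_pi_pos x
  rw [hy2]
  exact hM y (Set.Ico_subset_Icc_self hy)

lemma KS.lim (h : KS ρ Θ a b) {κ T α L : ℝ} (hκ : 0 < κ) (hT : 0 < T)
    (hα : ∀ t ≥ T, C (a t) (b t) (Θ t α) ≤ -κ) (hL : Tendsto (fun t => Θ t α) atTop (nhds L))
    {f : ℝ → ℝ} (hf : Continuous f) (hp : Function.Periodic f (2 * π)) :
    Tendsto (fun t => ∫ θ, f (Θ t θ) ∂ρ) atTop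
      (nhds ((1 - ρ.real {θ | Y Θ α 0 θ = 0}) * f (L + π) + ρ.real {θ | Y Θ α 0 θ = 0} * f (L + π + π))) := by
  obtain ⟨M, hM⟩ := periodic_bdd hf hp
  set A := {θ | Y Θ α 0 θ = 0} with hA
  have hAm : MeasurableSet A := h.meas_set α
  have key := tendsto_integral_filter_of_dominated_convergence (μ := ρ) (l := atTop)
    (F := fun t θ => f (Θ t θ))
    (f := fun θ => f (L + π) + A.indicator (fun _ => f L - f (L + π)) θ) (fun _ => M)
    (by filter_upwards [eventually_ge_atTop 0] with x hx
        exact (hf.comp (h.cont x hx)).aestronglyMeasurable)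
    (Eventually.of_forall fun t => ae_of_all _ fun θ => hM _)
    (integrable_const _)
    (ae_of_all _ fun θ => by
      by_cases h0 : Y Θ α 0 θ = 0
      · have : θ ∈ A := h0
        rw [Set.indicator_of_mem this, add_sub_cancel]
        refine ((hf.tendsto L).comp hL).congr' ?_
        filter_upwards [eventually_ge_atTop 0] with t ht
        have h1 := h.Y_zero α θ ht h0
        obtain ⟨n, hn⟩ := sin_eq_zero_iff.1 h1
        have : Θ t θ = Θ t α + n * (2 * π) := by unfold D at hn; linarith
        rw [Function.comp, this, (hp.int_mul n) (Θ t α)]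
      · have : θ ∉ A := h0
        rw [Set.indicator_of_notMem this, add_zero]
        have h1 : Tendsto (fun t => Θ t α + π - 2 * arctan (U Θ α t θ)) atTop (nhds (L + π)) := by
          have h2 := (continuous_arctan.tendsto 0).comp (h.U_tendsto hκ hT hα h0)
          have h3 := (hL.add_const π).sub (h2.const_mul 2)
          simpa using h3
        refine ((hf.tendsto (L + π)).comp h1).congr' ?_
        filter_upwards [eventually_ge_atTop 0] with t ht
        have hy := h.Y_ne_zero α θ ht h0
        have h4 : sin (π / 2 - D Θ α t θ / 2 - arctan (U Θ α t θ)) = 0 := by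
          rw [sin_sub, sin_pi_div_two_sub, cos_pi_div_two_sub, sin_arctan, cos_arctan]
          have : cos (D Θ α t θ / 2) = U Θ α t θ * sin (D Θ α t θ / 2) := by
            change Z Θ α t θ = U Θ α t θ * Y Θ α t θ
            unfold U; field_simp
          rw [this]; ring
        obtain ⟨n, hn⟩ := sin_eq_zero_iff.1 h4
        have : Θ t α + π - 2 * arctan (U Θ α t θ) = Θ t θ + n * (2 * π) := by
          unfold D at hn; linarith
        rw [Function.comp, this, (hp.int_mul n) (Θ t θ)])
  convert key using 2
  rw [integral_add (integrable_const _) ((integrable_const _).indicator hAm),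
    integral_indicator_const _ hAm]
  have : f (L + π + π) = f L := by rw [show L + π + π = L + 2 * π by ring]; exact hp L
  rw [this]
  simp; ring

lemma KS.main (h : KS ρ Θ a b) {t1 : ℝ} (ht1 : 0 < t1) (hpos : 0 < a t1 ^ 2 + b t1 ^ 2) :
    ∃ (φstar α c₁ c₂ : ℝ),
      c₁ ≥ c₂ ∧ c₂ ≥ 0 ∧ c₁ + c₂ = 1 ∧
      c₂ = (ρ {θ : ℝ | ∃ m : ℤ, θ - α = 2 * π * m}).toReal ∧
      ∀ h : ℝ → ℝ, Continuous h → Function.Periodic h (2*π) →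
        Tendsto (fun t => ∫ θ, h (Θ t θ) ∂ρ) atTop
          (nhds (c₁ * h φstar + c₂ * h (φstar + π))) := by
  obtain ⟨κ, hκ, T, hT, α, hα⟩ := h.exists_alpha ht1 hpos
  obtain ⟨L, hL⟩ := h.omega_tendsto hκ hT hα
  have lim := fun f hf hp => h.lim hκ hT hα hL (f := f) hf hp
  have hset : {θ | Y Θ α 0 θ = 0} = {θ : ℝ | ∃ m : ℤ, θ - α = 2 * π * m} := by
    ext θ
    simp only [Set.mem_ofPred_eq, Y, D, h.init, sin_eq_zero_iff]
    constructor
    · rintro ⟨n, hn⟩; exact ⟨n, by linarith⟩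
    · rintro ⟨n, hn⟩; exact ⟨n, by linarith⟩
  refine ⟨L + π, α, 1 - ρ.real {θ | Y Θ α 0 θ = 0}, ρ.real {θ | Y Θ α 0 θ = 0}, ?_,
    measureReal_nonneg, by ring, by rw [hset]; rfl, lim⟩
  set c := ρ.real {θ | Y Θ α 0 θ = 0}
  have l1 := lim cos continuous_cos cos_periodic
  have l2 := lim sin continuous_sin sin_periodic
  have l3 : Tendsto (fun t => C (a t) (b t) (Θ t α)) atTop (nhds (-(1 - 2 * c))) := by
    have := (l1.mul ((continuous_cos.tendsto L).comp hL)).add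
      (l2.mul ((continuous_sin.tendsto L).comp hL))
    have e : -(1 - 2 * c) = ((1 - c) * cos (L + π) + c * cos (L + π + π)) * cos L +
        ((1 - c) * sin (L + π) + c * sin (L + π + π)) * sin L := by
      simp only [cos_add_pi, sin_add_pi]
      linear_combination (1 - 2 * c) * sin_sq_add_cos_sq L
    rw [e]
    refine this.congr' ?_
    filter_upwards [eventually_ge_atTop 0] with t ht
    rw [C, h.ha t ht, h.hb t ht]; rfl
  have := le_of_tendsto l3 (eventually_atTop.2 ⟨T, hα⟩)
  change c ≤ 1 - c
  linarith

end KK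

theorem kinetic_kuramoto_weak_star_convergence
    (ρ₀ : Measure ℝ) [IsProbabilityMeasure ρ₀]
    (Θ : ℝ → ℝ → ℝ) (z : ℝ → ℂ)
    (hz : ∀ t, z t = ∫ θ, Complex.exp (Complex.I * (Θ t θ : ℂ)) ∂ρ₀)
    (hinit : ∀ θ, Θ 0 θ = θ)
    (hode : ∀ θ : ℝ, ∀ t ≥ (0:ℝ),
      HasDerivAt (fun s => Θ s θ)
        (-(Complex.exp (Complex.I * (Θ t θ : ℂ)) * (starRingEnd ℂ) (z t)).im) t)
    (hnonstat : ¬ (∀ t ≥ (0:ℝ), Measure.map (Θ t) ρ₀ = ρ₀)) :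
    ∃ (φstar α c₁ c₂ : ℝ),
      c₁ ≥ c₂ ∧ c₂ ≥ 0 ∧ c₁ + c₂ = 1 ∧
      c₂ = (ρ₀ {θ : ℝ | ∃ m : ℤ, θ - α = 2 * π * m}).toReal ∧
      ∀ h : ℝ → ℝ, Continuous h → Function.Periodic h (2*π) →
        Tendsto (fun t => ∫ θ, h (Θ t θ) ∂ρ₀) atTop
          (nhds (c₁ * h φstar + c₂ * h (φstar + π))) := by
  have hre : ∀ x : ℝ, (Complex.exp (Complex.I * (x : ℂ))).re = cos x := fun x => by
    rw [mul_comm, Complex.exp_ofReal_mul_I_re]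
  have him : ∀ x : ℝ, (Complex.exp (Complex.I * (x : ℂ))).im = sin x := fun x => by
    rw [mul_comm, Complex.exp_ofReal_mul_I_im]
  have hnorm : ∀ x : ℝ, ‖Complex.exp (Complex.I * (x : ℂ))‖ = 1 := fun x => by
    rw [mul_comm, Complex.norm_exp_ofReal_mul_I]
  have hzle : ∀ t, ‖z t‖ ≤ 1 := fun t => by
    rw [hz t]
    have := norm_integral_le_of_norm_le_const (μ := ρ₀) (C := 1)
      (f := fun θ => Complex.exp (Complex.I * (Θ t θ : ℂ))) (ae_of_all _ fun θ => (hnorm _).le)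
    simpa using this
  have ode : ∀ θ, ∀ t ≥ (0:ℝ), HasDerivAt (fun s => Θ s θ)
      (- KK.S (z t).re (z t).im (Θ t θ)) t := fun θ t ht => by
    refine (hode θ t ht).congr_deriv ?_
    rw [Complex.mul_im, hre, him, Complex.conj_re, Complex.conj_im, KK.S]
    ring
  have ode2 : ∀ θ, ∀ t ≥ (0:ℝ), HasDerivAt (fun s => Θ s θ)
      ((z t).im * cos (Θ t θ) - (z t).re * sin (Θ t θ)) t := fun θ t ht => by
    refine (ode θ t ht).congr_deriv ?_
    rw [KK.S]; ring
  have hcomp := fun (f g : ℝ → ℝ) hf hg (t : ℝ) (ht : 0 ≤ t) =>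
    KK.ode_compare (f := f) (g := g) (a := fun t => (z t).re) (b := fun t => (z t).im)
      (fun t _ => (Complex.abs_re_le_norm _).trans (hzle t))
      (fun t _ => (Complex.abs_im_le_norm _).trans (hzle t)) hf hg ht
  have hcont : ∀ t ≥ (0:ℝ), Continuous (Θ t) := fun t ht => by
    refine (LipschitzWith.of_dist_le_mul (K := ⟨exp (2 * t), (exp_pos _).le⟩) fun x y => ?_).continuous
    have := hcomp _ _ (ode2 x) (ode2 y) t ht
    simp only [hinit] at this
    rw [Real.dist_eq, Real.dist_eq, mul_comm]
    exact this
  have hint : ∀ t ≥ (0:ℝ), Integrable (fun θ => Complex.exp (Complex.I * (Θ t θ : ℂ))) ρ₀ :=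
    fun t ht => by
      have := hcont t ht
      exact Integrable.of_bound (by fun_prop : Continuous fun θ =>
        Complex.exp (Complex.I * (Θ t θ : ℂ))).aestronglyMeasurable 1
        (ae_of_all _ fun θ => (hnorm _).le)
  have hKS : KK.KS ρ₀ Θ (fun t => (z t).re) (fun t => (z t).im) :=
    { cont := hcont
      ha := fun t ht => by
        have := integral_re (hint t ht)
        rw [hz t]
        refine this.symm.trans ?_
        congr 1; ext θ; exact hre _
      hb := fun t ht => by
        have := integral_im (hint t ht)
        rw [hz t]
        refine this.symm.trans ?_
        congr 1; ext θ; exact him _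
      sq := fun t _ => by
        have h1 := hzle t
        have h2 := Complex.sq_norm (z t)
        rw [Complex.normSq_apply] at h2
        nlinarith [norm_nonneg (z t)]
      init := hinit
      ode := ode
      per := fun t ht θ => by
        have := hcomp (fun s => Θ s (θ + 2 * π)) (fun s => Θ s θ + 2 * π) (ode2 _)
          (fun t ht => by
            simpa using (ode2 θ t ht).add_const (2 * π)) t ht
        simp only [hinit, sub_self, abs_zero, zero_mul] at this
        have := abs_nonpos_iff.1 this
        linarith }
  have hex : ∃ t1 > 0, z t1 ≠ 0 := by
    by_contra hcon
    push Not at hcon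
    apply hnonstat
    intro t ht
    have hid : Θ t = id := by
      ext θ
      rcases ht.eq_or_lt with h0 | h0
      · rw [← h0, hinit]; rfl
      obtain ⟨c, hc, hc2⟩ := exists_hasDerivAt_eq_slope (fun s => Θ s θ) _ h0
        (fun x hx => (ode2 θ x hx.1).continuousAt.continuousWithinAt)
        (fun x hx => ode2 θ x hx.1.le)
      rw [hcon c hc.1, hinit] at hc2
      have hc3 : (0:ℝ) = (Θ t θ - θ) / (t - 0) := by
        rw [← hc2]; simp
      have : Θ t θ - θ = 0 := by
        rw [sub_zero, eq_div_iff h0.ne'] at hc3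
        linarith
      simp; linarith
    rw [hid, Measure.map_id]
  obtain ⟨t1, ht1, hz1⟩ := hex
  refine hKS.main ht1 ?_
  have h1 : 0 < Complex.normSq (z t1) := Complex.normSq_pos.2 hz1
  rw [Complex.normSq_apply] at h1
  change 0 < (z t1).re ^ 2 + (z t1).im ^ 2
  nlinarith
end

section
/- Let Θ be the characteristics of the kinetic Kuramoto model for identical oscillators with initial measure ρ₀, suppose the solution is not stationary, and suppose ρ₀ is non-atomic (it gives zero measure to every point mod 2π). Then the solution converges weak-* to a completely phase-synchronized state: there exists φ* ∈ ℝ such that for every continuous 2π-periodic function h, ∫ h(Θ(t,θ)) dρ₀(θ) → h(φ*) as t → ∞, i.e. ρ(t,·) → δ_{φ*}. -/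
open MeasureTheory Filter Real

lemma aux_mono (T : ℝ) (f f' : ℝ → ℝ) (hc : ContinuousOn f (Set.Ici T))
    (hd : ∀ t, T < t → HasDerivAt f (f' t) t) (hn : ∀ t, T < t → 0 ≤ f' t) :
    ∀ s t, T ≤ s → s ≤ t → f s ≤ f t := by
  have h := monotoneOn_of_deriv_nonneg (convex_Ici T) hc
    (by
      rw [interior_Ici]
      intro x hx
      exact (hd x hx).differentiableAt.differentiableWithinAt)
    (by
      rw [interior_Ici]
      intro x hx
      rw [(hd x hx).deriv]
      exact hn x hx)
  intro s t hs hst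
  exact h hs (le_trans hs hst) hst

lemma aux_exp_bounds (q k : ℝ → ℝ) (C : ℝ) (hc : ContinuousOn q (Set.Ici 0))
    (hd : ∀ t, 0 < t → HasDerivAt q (k t * q t) t) (hk : ∀ t, 0 < t → |k t| ≤ C)
    (hq : ∀ t, 0 ≤ q t) (s t : ℝ) (hs : 0 ≤ s) (ht : 0 ≤ t) (h0 : q s = 0) : q t = 0 := by
  have h1 := aux_mono 0 (fun t => q t * exp (C * t))
    (fun t => k t * q t * exp (C * t) + q t * (exp (C * t) * C))
    (hc.mul (by fun_prop))
    (fun t ht => (hd t ht).mul (by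
      have := ((hasDerivAt_id t).const_mul C).exp
      simpa using this))
    (fun t ht => by
      have := (abs_le.1 (hk t ht)).1
      have h2 : 0 ≤ (k t + C) * (q t * exp (C * t)) :=
        mul_nonneg (by linarith) (mul_nonneg (hq t) (exp_pos _).le)
      nlinarith)
  have h2 := aux_mono 0 (fun t => -(q t * exp (-C * t)))
    (fun t => -(k t * q t * exp (-C * t) + q t * (exp (-C * t) * (-C))))
    (hc.mul (by fun_prop)).neg
    (fun t ht => ((hd t ht).mul (by
      have := ((hasDerivAt_id t).const_mul (-C)).exp
      simpa using this)).neg)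
    (fun t ht => by
      have := (abs_le.1 (hk t ht)).2
      have h2 : 0 ≤ (C - k t) * (q t * exp (-C * t)) :=
        mul_nonneg (by linarith) (mul_nonneg (hq t) (exp_pos _).le)
      nlinarith)
  rcases le_total s t with h | h
  · have := h2 s t hs h
    simp only [h0, zero_mul, neg_zero] at this
    have h3 := exp_pos (-C * t)
    have h4 := hq t
    by_contra hne
    have : 0 < q t := lt_of_le_of_ne h4 (Ne.symm hne)
    have := mul_pos this h3
    linarith
  · have := h1 t s ht h
    simp only [h0, zero_mul] at this
    have h3 := exp_pos (C * t)
    have h4 := hq t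
    by_contra hne
    have : 0 < q t := lt_of_le_of_ne h4 (Ne.symm hne)
    have := mul_pos this h3
    linarith

lemma aux_growth (q k : ℝ → ℝ) (c T : ℝ) (hc0 : 0 < c)
    (hd : ∀ t, T < t → HasDerivAt q (k t * q t) t) (hcont : ContinuousOn q (Set.Ici T))
    (hk : ∀ t, T < t → c ≤ k t) (hq : ∀ t, 0 ≤ q t) (hq4 : ∀ t, q t ≤ 4) : q T = 0 := by
  by_contra hne
  have hpos : 0 < q T := lt_of_le_of_ne (hq T) (Ne.symm hne)
  have h1 := aux_mono T q _ hcont hd (fun t ht => mul_nonneg (hc0.le.trans (hk t ht)) (hq t))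
  have h2 := aux_mono T (fun t => q t - c * q T * t) (fun t => k t * q t - c * q T)
    (hcont.sub (by fun_prop))
    (fun t ht => (hd t ht).sub (by simpa using (hasDerivAt_id t).const_mul (c * q T)))
    (fun t ht => by
      have a1 := h1 T t le_rfl ht.le
      have a2 := hk t ht
      have : c * q T ≤ k t * q t := mul_le_mul a2 a1 hpos.le (hc0.le.trans a2)
      linarith)
  have hcq : 0 < c * q T := mul_pos hc0 hpos
  have h3 := h2 T (T + 5 / (c * q T)) le_rfl (by linarith [div_pos (by norm_num : (0:ℝ) < 5) hcq])
  have h4 := hq4 (T + 5 / (c * q T))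
  have h5 : c * q T * (T + 5 / (c * q T)) = c * q T * T + 5 := by
    field_simp
  simp only [h5] at h3
  linarith

lemma aux_dich (g f : ℝ → ℝ) (r : ℝ) (hr : 0 < r)
    (hd : ∀ t, 0 < t → HasDerivAt g (r ^ 2 - g t ^ 2 + f t) t)
    (hf : Tendsto f atTop (nhds 0)) (hg : ∀ t, 0 < t → |g t| ≤ r) :
    Tendsto g atTop (nhds r) ∨ Tendsto g atTop (nhds (-r)) := by
  by_cases hcase : Tendsto g atTop (nhds (-r))
  · exact Or.inr hcase
  left
  rw [Metric.tendsto_atTop] at hcase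
  push Not at hcase
  obtain ⟨δ0, hδ0, hfreq⟩ := hcase
  rw [Metric.tendsto_atTop]
  intro ε hε
  set δ := min (min δ0 (ε / 2)) (r / 2) with hδ
  have hδpos : 0 < δ := by positivity
  have hδ1 : δ ≤ δ0 := (min_le_left _ _).trans (min_le_left _ _)
  have hδ2 : δ ≤ ε / 2 := (min_le_left _ _).trans (min_le_right _ _)
  have hδ3 : δ ≤ r / 2 := min_le_right _ _
  have hη : 0 < δ * r / 2 := by positivity
  obtain ⟨T, hT⟩ := (Metric.tendsto_atTop.1 hf) (δ * r / 2) hη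
  obtain ⟨t0, ht0, hgt0⟩ := hfreq (max T 1)
  have hT0 : T ≤ t0 := (le_max_left _ _).trans ht0
  have h10 : 1 ≤ t0 := (le_max_right _ _).trans ht0
  have hfb : ∀ t, t0 ≤ t → -(δ * r / 2) < f t := by
    intro t ht
    have := hT t (hT0.trans ht)
    rw [Real.dist_eq, sub_zero] at this
    exact (abs_lt.1 this).1
  have hvel : ∀ t, t0 ≤ t → -r + δ ≤ g t → g t ≤ r - δ →
      δ * r / 2 ≤ r ^ 2 - g t ^ 2 + f t := by
    intro t ht h1 h2
    have := hfb t ht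
    have h3 : g t ^ 2 ≤ (r - δ) ^ 2 := by
      apply sq_le_sq'
      · linarith
      · exact h2
    nlinarith
  have hstart : -r + δ ≤ g t0 := by
    rw [Real.dist_eq] at hgt0
    have h1 := (abs_le.1 (hg t0 (by linarith))).1
    rw [abs_of_nonneg (by linarith)] at hgt0
    linarith
  have barrier : ∀ c, -r + δ ≤ c → c ≤ r - δ → ∀ s, t0 ≤ s → c ≤ g s → ∀ t, s ≤ t → c ≤ g t := by
    intro c hc1 hc2 s hs hgs t hst
    have := image_le_of_deriv_right_lt_deriv_boundary' (f := fun t => - g t)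
      (f' := fun t => -(r ^ 2 - g t ^ 2 + f t)) (a := s) (b := t)
      (fun x hx => (hd x (by linarith [hx.1])).continuousAt.continuousWithinAt.neg)
      (fun x hx => (hd x (by linarith [hx.1])).neg.hasDerivWithinAt)
      (B := fun _ => -c) (B' := fun _ => 0) (by simpa using hgs) continuousOn_const
      (fun x hx => hasDerivWithinAt_const _ _ _)
      (fun x hx hxe => by
        have hxe' : g x = c := by simpa using hxe
        have := hvel x (by linarith [hx.1]) (by linarith) (by linarith)
        linarith) (Set.right_mem_Icc.2 hst)
    linarith
  have hlow := barrier (-r + δ) le_rfl (by linarith) t0 le_rfl hstart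
  have hreach : ∃ s, t0 ≤ s ∧ r - δ ≤ g s := by
    by_contra hno
    push Not at hno
    have h2 := aux_mono t0 (fun t => g t - δ * r / 2 * t)
      (fun t => (r ^ 2 - g t ^ 2 + f t) - δ * r / 2)
      (fun x hx => by
        have hx' : t0 ≤ x := hx
        exact ((hd x (by linarith)).continuousAt.continuousWithinAt).sub
          (by fun_prop))
      (fun t ht => (hd t (by linarith)).sub
        (by simpa using (hasDerivAt_id t).const_mul (δ * r / 2)))
      (fun t ht => by
        have := hvel t ht.le (hlow t ht.le) (hno t ht.le).le
        linarith)
    have h3 := h2 t0 (t0 + (2 * r) / (δ * r / 2)) le_rfl (by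
      have : 0 < (2 * r) / (δ * r / 2) := by positivity
      linarith)
    have h5 : δ * r / 2 * (t0 + (2 * r) / (δ * r / 2)) = δ * r / 2 * t0 + 2 * r := by
      field_simp
    simp only [h5] at h3
    have h6 := hno (t0 + (2 * r) / (δ * r / 2)) (by
      have : 0 < (2 * r) / (δ * r / 2) := by positivity
      linarith)
    linarith
  obtain ⟨s, hs, hgs⟩ := hreach
  refine ⟨s, fun t ht => ?_⟩
  have h1 := barrier (r - δ) (by linarith) le_rfl s hs hgs t ht
  have h2 := (abs_le.1 (hg t (by linarith))).2
  rw [Real.dist_eq, abs_sub_lt_iff]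
  constructor <;> linarith

lemma aux_exists_cos_ne (a b : ℝ) (hab : a < b) : ∃ c, a < c ∧ c < b ∧ cos c ≠ 1 := by
  by_contra hno
  push Not at hno
  obtain ⟨m, hm⟩ : ∃ m, m = (a + b) / 2 := ⟨_, rfl⟩
  have h1 : ∀ᶠ x in nhds m, cos x = 1 := by
    filter_upwards [Ioo_mem_nhds (show a < m by linarith) (show m < b by linarith)] with x hx
    exact hno x hx.1 hx.2
  have h2 : ∀ᶠ x in nhds m, sin x = 0 := by
    filter_upwards [h1] with x hx
    have := sin_sq_add_cos_sq x
    rw [hx] at this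
    nlinarith
  have h3 : HasDerivAt sin 0 m := by
    apply (hasDerivAt_const m (0:ℝ)).congr_of_eventuallyEq
    exact h2
  have h4 := h3.unique (Real.hasDerivAt_sin m)
  rw [h1.self_of_nhds] at h4
  norm_num at h4

lemma aux_conv (d : ℝ → ℝ) (M : ℝ) (hc : ContinuousOn d (Set.Ici 0))
    (hb : ∀ t, 0 ≤ t → |d t| ≤ M) (hcos : Tendsto (fun t => cos (d t)) atTop (nhds 1)) :
    ∃ L, Tendsto d atTop (nhds L) ∧ cos L = 1 := by
  have key : ∃ L, Tendsto d atTop (nhds L) := by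
    refine tendsto_of_no_upcrossings dense_univ ?_ ?_ ?_
    · rintro a - b - hab ⟨h1, h2⟩
      obtain ⟨c, hac, hcb, hne⟩ := aux_exists_cos_ne a b hab
      have hev : ∀ᶠ t in atTop, cos (d t) ≠ cos c := hcos.eventually_ne (Ne.symm hne)
      obtain ⟨T, hT⟩ := eventually_atTop.1 hev
      obtain ⟨s, hs, hsa⟩ := (frequently_atTop.1 h1) (max T 0)
      obtain ⟨t, ht, htb⟩ := (frequently_atTop.1 h2) (max T 0)
      have hsub : Set.uIcc s t ⊆ Set.Ici (max T 0) := by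
        intro x hx
        exact (le_min hs ht).trans hx.1
      have := intermediate_value_uIcc (f := d) (a := s) (b := t)
        (hc.mono (hsub.trans (Set.Ici_subset_Ici.2 (le_max_right _ _))))
      obtain ⟨x, hx, hxc⟩ := this (show c ∈ Set.uIcc (d s) (d t) from
        Set.mem_uIcc.2 (Or.inl ⟨by linarith, by linarith⟩))
      exact hT x ((le_max_left _ _).trans (hsub hx)) (by rw [hxc])
    · exact ⟨M, eventually_map.2 (eventually_atTop.2 ⟨0, fun t ht => (abs_le.1 (hb t ht)).2⟩)⟩
    · exact ⟨-M, eventually_map.2 (eventually_atTop.2 ⟨0, fun t ht => (abs_le.1 (hb t ht)).1⟩)⟩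
  obtain ⟨L, hL⟩ := key
  exact ⟨L, hL, tendsto_nhds_unique ((continuous_cos.tendsto L).comp hL) hcos⟩

lemma aux_stay (d : ℝ → ℝ) (hc : ContinuousOn d (Set.Ici 0))
    (hz : ∀ s t, 0 ≤ s → 0 ≤ t → cos (d s) = 1 → cos (d t) = 1) (t : ℝ) (ht : 0 ≤ t) :
    |d t - d 0| ≤ 2 * π := by
  by_contra hno
  push Not at hno
  have hiv := intermediate_value_uIcc (f := d) (a := 0) (b := t)
    (hc.mono (fun x hx => by
      rw [Set.uIcc_of_le ht] at hx
      exact hx.1))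
  have hlt : min (d 0) (d t) + 2 * π < max (d 0) (d t) := by
    rcases le_total (d 0) (d t) with h | h
    · rw [abs_of_nonneg (by linarith)] at hno
      rw [min_eq_left h, max_eq_right h]; linarith
    · rw [abs_of_nonpos (by linarith)] at hno
      rw [min_eq_right h, max_eq_left h]; linarith
  set m := min (d 0) (d t)
  set M := max (d 0) (d t)
  have hpi := pi_pos
  obtain ⟨c, h1, h2, h3⟩ := aux_exists_cos_ne m M (by linarith)
  obtain ⟨x, hx, hxc⟩ := hiv (show c ∈ Set.uIcc (d 0) (d t) from ⟨h1.le, h2.le⟩)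
  -- a multiple of 2π
  have hk : ∃ y, m ≤ y ∧ y ≤ M ∧ cos y = 1 := by
    refine ⟨⌈m / (2 * π)⌉ * (2 * π), ?_, ?_, (cos_eq_one_iff _).2 ⟨_, rfl⟩⟩
    · have := Int.le_ceil (m / (2 * π))
      rwa [div_le_iff₀ (by positivity)] at this
    · have := Int.ceil_lt_add_one (m / (2 * π))
      have h4 : (⌈m / (2 * π)⌉ : ℝ) * (2 * π) < (m / (2 * π) + 1) * (2 * π) :=
        mul_lt_mul_of_pos_right this (by positivity)
      have h5 : (m / (2 * π) + 1) * (2 * π) = m + 2 * π := by field_simp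
      linarith
  obtain ⟨y, hy1, hy2, hy3⟩ := hk
  obtain ⟨u, hu, huy⟩ := hiv (show y ∈ Set.uIcc (d 0) (d t) from ⟨hy1, hy2⟩)
  rw [Set.uIcc_of_le ht] at hx hu
  have := hz u x hu.1 hx.1 (by rw [huy, hy3])
  rw [hxc] at this
  exact h3 this

lemma aux_diff_int (ρ : Measure ℝ) [IsProbabilityMeasure ρ] (F F' : ℝ → ℝ → ℝ) (C : ℝ)
    (hF : ∀ t, 0 ≤ t → Continuous (F t)) (hF' : ∀ t, 0 ≤ t → Continuous (F' t))
    (hC : ∀ t θ, 0 ≤ t → |F' t θ| ≤ C) (hint : ∀ t, 0 ≤ t → Integrable (F t) ρ)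
    (hd : ∀ θ t, 0 ≤ t → HasDerivAt (fun s => F s θ) (F' t θ) t) (t : ℝ) (ht : 0 < t) :
    HasDerivAt (fun s => ∫ θ, F s θ ∂ρ) (∫ θ, F' t θ ∂ρ) t := by
  refine (hasDerivAt_integral_of_dominated_loc_of_deriv_le (s := Set.Ioi 0)
    (bound := fun _ => C) (Ioi_mem_nhds ht) ?_ (hint t ht.le) ?_ ?_ ?_ ?_).2
  · filter_upwards [Ioi_mem_nhds ht] with x hx
    exact (hF x (le_of_lt hx)).aestronglyMeasurable
  · exact (hF' t ht.le).aestronglyMeasurable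
  · refine Eventually.of_forall fun θ x hx => ?_
    exact hC x θ (le_of_lt hx)
  · exact integrable_const _
  · refine Eventually.of_forall fun θ x hx => ?_
    exact hd θ x (le_of_lt hx)

lemma aux_lip_int (ρ : Measure ℝ) [IsProbabilityMeasure ρ] (F : ℝ → ℝ → ℝ) (C : ℝ)
    (hint : ∀ t, 0 ≤ t → Integrable (F t) ρ)
    (hL : ∀ θ s t, 0 ≤ s → 0 ≤ t → |F t θ - F s θ| ≤ C * |t - s|) (s t : ℝ)
    (hs : 0 ≤ s) (ht : 0 ≤ t) :
    |∫ θ, F t θ ∂ρ - ∫ θ, F s θ ∂ρ| ≤ C * |t - s| := by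
  rw [← integral_sub (hint t ht) (hint s hs)]
  have := norm_integral_le_of_norm_le_const (μ := ρ) (f := fun θ => F t θ - F s θ)
    (C := C * |t - s|) (Eventually.of_forall fun θ => hL θ s t hs ht)
  simpa using this

lemma aux_lip_cont (f : ℝ → ℝ) (C : ℝ) 
    (hL : ∀ s t, 0 ≤ s → 0 ≤ t → |f t - f s| ≤ C * |t - s|) : ContinuousOn f (Set.Ici 0) := by
  have hC : LipschitzOnWith (Real.toNNReal C) f (Set.Ici 0) := by
    apply LipschitzOnWith.of_dist_le_mul
    intro x hx y hy
    rw [Real.dist_eq, Real.dist_eq]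
    refine (hL y x hy hx).trans ?_
    exact mul_le_mul_of_nonneg_right (Real.le_coe_toNNReal C) (abs_nonneg _)
  exact hC.continuousOn

lemma aux_bdd_int (ρ : Measure ℝ) [IsProbabilityMeasure ρ] (f : ℝ → ℝ) (C : ℝ)
    (hf : Continuous f) (hb : ∀ x, |f x| ≤ C) : Integrable f ρ :=
  Integrable.of_bound hf.aestronglyMeasurable C (Eventually.of_forall hb)

lemma aux_deriv_lip (f f' : ℝ → ℝ) (C : ℝ) (hd : ∀ t, 0 ≤ t → HasDerivAt f (f' t) t)
    (hC : ∀ t, 0 ≤ t → |f' t| ≤ C) (s t : ℝ) (hs : 0 ≤ s) (ht : 0 ≤ t) :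
    |f t - f s| ≤ C * |t - s| :=
  Convex.norm_image_sub_le_of_norm_hasDerivWithin_le (s := Set.Ici 0) (f' := f')
    (fun x hx => (hd x hx).hasDerivWithinAt) (fun x hx => hC x hx) (convex_Ici 0) hs ht

lemma aux_cos_lip (x y : ℝ) : |cos x - cos y| ≤ |x - y| := by
  have := Convex.norm_image_sub_le_of_norm_hasDerivWithin_le (s := Set.univ) (f := cos)
    (f' := fun x => -sin x) (C := 1) (x := y) (y := x)
    (fun x hx => (Real.hasDerivAt_cos x).hasDerivWithinAt)
    (fun x hx => by simpa using abs_sin_le_one x) convex_univ trivial trivial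
  simpa using this

lemma aux_sin_lip (x y : ℝ) : |sin x - sin y| ≤ |x - y| := by
  have := Convex.norm_image_sub_le_of_norm_hasDerivWithin_le (s := Set.univ) (f := sin)
    (f' := fun x => cos x) (C := 1) (x := y) (y := x)
    (fun x hx => (Real.hasDerivAt_sin x).hasDerivWithinAt)
    (fun x hx => by simpa using abs_cos_le_one x) convex_univ trivial trivial
  simpa using this

lemma aux_mul_lip (a b c d A B X Y: ℝ) (hA : |a - b| ≤ X) (hB : |c - d| ≤ Y) (h1 : |a| ≤ A)
    (h2 : |d| ≤ B) : |a * c - b * d| ≤ A * Y + B * X := by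
  have : a * c - b * d = a * (c - d) + d * (a - b) := by ring
  rw [this]
  refine (abs_add_le _ _).trans ?_
  rw [abs_mul, abs_mul]
  have := abs_nonneg (c - d)
  have := abs_nonneg (a - b)
  have := abs_nonneg a
  have := abs_nonneg d
  exact add_le_add (mul_le_mul h1 hB (by assumption) (by linarith))
    (mul_le_mul h2 hA (by assumption) (by linarith))

structure KSys (ρ : Measure ℝ) (Θ : ℝ → ℝ → ℝ) (a b : ℝ → ℝ) : Prop where
  ha : ∀ t, 0 ≤ t → a t = ∫ θ, cos (Θ t θ) ∂ρ
  hb : ∀ t, 0 ≤ t → b t = ∫ θ, sin (Θ t θ) ∂ρ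
  ha1 : ∀ t, |a t| ≤ 1
  hb1 : ∀ t, |b t| ≤ 1
  hinit : ∀ θ, Θ 0 θ = θ
  hcont : ∀ t, 0 ≤ t → Continuous (Θ t)
  hode : ∀ θ t, 0 ≤ t →
    HasDerivAt (fun s => Θ s θ) (b t * cos (Θ t θ) - a t * sin (Θ t θ)) t

set_option linter.unusedSectionVars false
set_option linter.unusedVariables false

section
variable {ρ : Measure ℝ} [IsProbabilityMeasure ρ] {Θ : ℝ → ℝ → ℝ} {a b : ℝ → ℝ}

noncomputable def KV (Θ : ℝ → ℝ → ℝ) (a b : ℝ → ℝ) (t θ : ℝ) : ℝ := b t * cos (Θ t θ) - a t * sin (Θ t θ)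

lemma KSys.V_le (h : KSys ρ Θ a b) (t θ : ℝ) : |KV Θ a b t θ| ≤ 2 := by
  unfold KV
  refine (abs_sub _ _).trans ?_
  rw [abs_mul, abs_mul]
  have h1 := mul_le_mul (h.hb1 t) (abs_cos_le_one (Θ t θ)) (abs_nonneg _) zero_le_one
  have h2 := mul_le_mul (h.ha1 t) (abs_sin_le_one (Θ t θ)) (abs_nonneg _) zero_le_one
  linarith

lemma KSys.V_cont (h : KSys ρ Θ a b) (t : ℝ) (ht : 0 ≤ t) : Continuous (KV Θ a b t) := by
  unfold KV
  have := h.hcont t ht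
  fun_prop

lemma KSys.lip (h : KSys ρ Θ a b) (θ s t : ℝ) (hs : 0 ≤ s) (ht : 0 ≤ t) :
    |Θ t θ - Θ s θ| ≤ 2 * |t - s| :=
  aux_deriv_lip (fun t => Θ t θ) (fun t => KV Θ a b t θ) 2 (h.hode θ) (fun t _ => h.V_le t θ) s t hs ht

lemma KSys.cos_int (h : KSys ρ Θ a b) (t : ℝ) (ht : 0 ≤ t) :
    Integrable (fun θ => cos (Θ t θ)) ρ :=
  aux_bdd_int ρ _ 1 (continuous_cos.comp (h.hcont t ht)) (fun _ => abs_cos_le_one _)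

lemma KSys.sin_int (h : KSys ρ Θ a b) (t : ℝ) (ht : 0 ≤ t) :
    Integrable (fun θ => sin (Θ t θ)) ρ :=
  aux_bdd_int ρ _ 1 (continuous_sin.comp (h.hcont t ht)) (fun _ => abs_sin_le_one _)

lemma KSys.a_lip (h : KSys ρ Θ a b) (s t : ℝ) (hs : 0 ≤ s) (ht : 0 ≤ t) :
    |a t - a s| ≤ 2 * |t - s| := by
  rw [h.ha t ht, h.ha s hs]
  exact aux_lip_int ρ (fun t θ => cos (Θ t θ)) 2 h.cos_int
    (fun θ s t hs ht => (aux_cos_lip _ _).trans (h.lip θ s t hs ht)) s t hs ht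

lemma KSys.b_lip (h : KSys ρ Θ a b) (s t : ℝ) (hs : 0 ≤ s) (ht : 0 ≤ t) :
    |b t - b s| ≤ 2 * |t - s| := by
  rw [h.hb t ht, h.hb s hs]
  exact aux_lip_int ρ (fun t θ => sin (Θ t θ)) 2 h.sin_int
    (fun θ s t hs ht => (aux_sin_lip _ _).trans (h.lip θ s t hs ht)) s t hs ht

lemma KSys.V_lip (h : KSys ρ Θ a b) (θ s t : ℝ) (hs : 0 ≤ s) (ht : 0 ≤ t) :
    |KV Θ a b t θ - KV Θ a b s θ| ≤ 8 * |t - s| := by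
  unfold KV
  have h1 := aux_mul_lip (b t) (b s) (cos (Θ t θ)) (cos (Θ s θ)) 1 1 _ _ (h.b_lip s t hs ht)
    ((aux_cos_lip _ _).trans (h.lip θ s t hs ht)) (h.hb1 t) (abs_cos_le_one _)
  have h2 := aux_mul_lip (a t) (a s) (sin (Θ t θ)) (sin (Θ s θ)) 1 1 _ _ (h.a_lip s t hs ht)
    ((aux_sin_lip _ _).trans (h.lip θ s t hs ht)) (h.ha1 t) (abs_sin_le_one _)
  have : b t * cos (Θ t θ) - a t * sin (Θ t θ) - (b s * cos (Θ s θ) - a s * sin (Θ s θ))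
    = (b t * cos (Θ t θ) - b s * cos (Θ s θ)) - (a t * sin (Θ t θ) - a s * sin (Θ s θ)) := by ring
  rw [this]
  refine (abs_sub _ _).trans ?_
  linarith

noncomputable def KA (ρ : Measure ℝ) (Θ : ℝ → ℝ → ℝ) (a b : ℝ → ℝ) (t : ℝ) : ℝ :=
  ∫ θ, -sin (Θ t θ) * KV Θ a b t θ ∂ρ
noncomputable def KB (ρ : Measure ℝ) (Θ : ℝ → ℝ → ℝ) (a b : ℝ → ℝ) (t : ℝ) : ℝ :=
  ∫ θ, cos (Θ t θ) * KV Θ a b t θ ∂ρ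
noncomputable def KJ (ρ : Measure ℝ) (Θ : ℝ → ℝ → ℝ) (a b : ℝ → ℝ) (t : ℝ) : ℝ :=
  ∫ θ, KV Θ a b t θ * KV Θ a b t θ ∂ρ

lemma KSys.sV_le (h : KSys ρ Θ a b) (t θ : ℝ) : |-sin (Θ t θ) * KV Θ a b t θ| ≤ |KV Θ a b t θ| := by
  rw [abs_mul, abs_neg]
  exact mul_le_of_le_one_left (abs_nonneg _) (abs_sin_le_one _)

lemma KSys.cV_le (h : KSys ρ Θ a b) (t θ : ℝ) : |cos (Θ t θ) * KV Θ a b t θ| ≤ |KV Θ a b t θ| := by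
  rw [abs_mul]
  exact mul_le_of_le_one_left (abs_nonneg _) (abs_cos_le_one _)

lemma KSys.sV_cont (h : KSys ρ Θ a b) (t : ℝ) (ht : 0 ≤ t) :
    Continuous (fun θ => -sin (Θ t θ) * KV Θ a b t θ) := by
  have := h.hcont t ht
  have := h.V_cont t ht
  fun_prop

lemma KSys.cV_cont (h : KSys ρ Θ a b) (t : ℝ) (ht : 0 ≤ t) :
    Continuous (fun θ => cos (Θ t θ) * KV Θ a b t θ) := by
  have := h.hcont t ht
  have := h.V_cont t ht
  fun_prop

lemma KSys.sV_int (h : KSys ρ Θ a b) (t : ℝ) (ht : 0 ≤ t) :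
    Integrable (fun θ => -sin (Θ t θ) * KV Θ a b t θ) ρ :=
  aux_bdd_int ρ _ 2 (h.sV_cont t ht) (fun θ => (h.sV_le t θ).trans (h.V_le t θ))

lemma KSys.cV_int (h : KSys ρ Θ a b) (t : ℝ) (ht : 0 ≤ t) :
    Integrable (fun θ => cos (Θ t θ) * KV Θ a b t θ) ρ :=
  aux_bdd_int ρ _ 2 (h.cV_cont t ht) (fun θ => (h.cV_le t θ).trans (h.V_le t θ))

lemma KSys.VV_int (h : KSys ρ Θ a b) (t : ℝ) (ht : 0 ≤ t) :
    Integrable (fun θ => KV Θ a b t θ * KV Θ a b t θ) ρ :=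
  aux_bdd_int ρ _ (2 * 2) ((h.V_cont t ht).mul (h.V_cont t ht)) (fun θ => by
    rw [abs_mul]
    exact mul_le_mul (h.V_le t θ) (h.V_le t θ) (abs_nonneg _) (by norm_num))

lemma KSys.a_deriv (h : KSys ρ Θ a b) (t : ℝ) (ht : 0 < t) :
    HasDerivAt a (KA ρ Θ a b t) t := by
  have := aux_diff_int ρ (fun t θ => cos (Θ t θ)) (fun t θ => -sin (Θ t θ) * KV Θ a b t θ) 2
    (fun t ht => continuous_cos.comp (h.hcont t ht)) h.sV_cont
    (fun t θ ht => (h.sV_le t θ).trans (h.V_le t θ)) h.cos_int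
    (fun θ t ht => (h.hode θ t ht).cos) t ht
  apply this.congr_of_eventuallyEq
  filter_upwards [Ioi_mem_nhds ht] with s hs
  exact h.ha s (le_of_lt hs)

lemma KSys.b_deriv (h : KSys ρ Θ a b) (t : ℝ) (ht : 0 < t) :
    HasDerivAt b (KB ρ Θ a b t) t := by
  have := aux_diff_int ρ (fun t θ => sin (Θ t θ)) (fun t θ => cos (Θ t θ) * KV Θ a b t θ) 2
    (fun t ht => continuous_sin.comp (h.hcont t ht)) h.cV_cont
    (fun t θ ht => (h.cV_le t θ).trans (h.V_le t θ)) h.sin_int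
    (fun θ t ht => (h.hode θ t ht).sin) t ht
  apply this.congr_of_eventuallyEq
  filter_upwards [Ioi_mem_nhds ht] with s hs
  exact h.hb s (le_of_lt hs)

lemma KSys.P_deriv (h : KSys ρ Θ a b) (t : ℝ) (ht : 0 < t) :
    HasDerivAt (fun t => a t ^ 2 + b t ^ 2) (2 * KJ ρ Θ a b t) t := by
  have h1 := ((h.a_deriv t ht).pow 2).add ((h.b_deriv t ht).pow 2)
  have : KJ ρ Θ a b t = a t * KA ρ Θ a b t + b t * KB ρ Θ a b t := by
    unfold KJ KA KB
    rw [← integral_const_mul, ← integral_const_mul, ← integral_add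
      ((h.sV_int t ht.le).const_mul _) ((h.cV_int t ht.le).const_mul _)]
    congr 1
    ext θ
    simp only [KV]
    ring
  have e : 2 * KJ ρ Θ a b t = (2 : ℕ) * a t ^ (2 - 1) * KA ρ Θ a b t
      + (2 : ℕ) * b t ^ (2 - 1) * KB ρ Θ a b t := by
    rw [this]
    push_cast
    ring
  rw [e]
  exact h1

lemma KSys.a_cont (h : KSys ρ Θ a b) : ContinuousOn a (Set.Ici 0) := aux_lip_cont a 2 h.a_lip
lemma KSys.b_cont (h : KSys ρ Θ a b) : ContinuousOn b (Set.Ici 0) := aux_lip_cont b 2 h.b_lip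

lemma KSys.P_cont (h : KSys ρ Θ a b) : ContinuousOn (fun t => a t ^ 2 + b t ^ 2) (Set.Ici 0) :=
  (h.a_cont.pow 2).add (h.b_cont.pow 2)

lemma KSys.J_nonneg (t : ℝ) : 0 ≤ KJ ρ Θ a b t :=
  integral_nonneg fun θ => mul_self_nonneg _

lemma KSys.P_mono (h : KSys ρ Θ a b) : ∀ s t, 0 ≤ s → s ≤ t →
    a s ^ 2 + b s ^ 2 ≤ a t ^ 2 + b t ^ 2 :=
  aux_mono 0 _ _ h.P_cont h.P_deriv (fun t _ => by
    have := KSys.J_nonneg (ρ := ρ) (Θ := Θ) (a := a) (b := b) t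
    linarith)

lemma KV_sq (t θ : ℝ) : KV Θ a b t θ * KV Θ a b t θ =
    a t ^ 2 + b t ^ 2 - (a t * cos (Θ t θ) + b t * sin (Θ t θ)) ^ 2 := by
  have := sin_sq_add_cos_sq (Θ t θ)
  unfold KV
  linear_combination (-(a t ^ 2 + b t ^ 2)) * (-this)

lemma KSys.J_le (h : KSys ρ Θ a b) (t : ℝ) (ht : 0 ≤ t) : KJ ρ Θ a b t ≤ a t ^ 2 + b t ^ 2 := by
  have := integral_mono (h.VV_int t ht) (integrable_const (μ := ρ) (a t ^ 2 + b t ^ 2))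
    (fun θ => by
      simp only [KV_sq]
      nlinarith [sq_nonneg (a t * cos (Θ t θ) + b t * sin (Θ t θ))])
  simpa [KJ] using this

lemma KSys.J_lip (h : KSys ρ Θ a b) (s t : ℝ) (hs : 0 ≤ s) (ht : 0 ≤ t) :
    |KJ ρ Θ a b t - KJ ρ Θ a b s| ≤ 32 * |t - s| := by
  refine aux_lip_int ρ (fun t θ => KV Θ a b t θ * KV Θ a b t θ) 32 h.VV_int
    (fun θ s t hs ht => ?_) s t hs ht
  have := aux_mul_lip _ _ _ _ 2 2 _ _ (h.V_lip θ s t hs ht) (h.V_lip θ s t hs ht) (h.V_le t θ)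
    (h.V_le s θ)
  linarith

/-- zero order parameter is preserved -/
lemma KSys.stationary (h : KSys ρ Θ a b) (h0 : a 0 ^ 2 + b 0 ^ 2 = 0) (t : ℝ) (ht : 0 ≤ t) :
    Θ t = id := by
  have hP : ∀ t, 0 ≤ t → a t ^ 2 + b t ^ 2 = 0 := by
    intro t ht
    have h2 := aux_mono 0 (fun t => -((a t ^ 2 + b t ^ 2) * exp (-2 * t)))
      (fun t => -(2 * KJ ρ Θ a b t * exp (-2 * t) + (a t ^ 2 + b t ^ 2) * (exp (-2 * t) * (-2))))
      (h.P_cont.mul (by fun_prop)).neg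
      (fun t ht => ((h.P_deriv t ht).mul (by
        have := ((hasDerivAt_id t).const_mul (-2)).exp
        simpa using this)).neg)
      (fun t ht => by
        have := h.J_le t ht.le
        have h2 : 0 ≤ (a t ^ 2 + b t ^ 2 - KJ ρ Θ a b t) * exp (-2 * t) :=
          mul_nonneg (by linarith) (exp_pos _).le
        nlinarith) 0 t le_rfl ht
    simp only [h0] at h2
    have h3 := exp_pos (-2 * t)
    by_contra hne
    have : 0 < a t ^ 2 + b t ^ 2 := lt_of_le_of_ne (by positivity) (Ne.symm hne)
    have := mul_pos this h3
    linarith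
  funext θ
  have := aux_deriv_lip (fun t => Θ t θ) (fun t => KV Θ a b t θ) 0 (h.hode θ) (fun t ht => by
    have h1 := KV_sq (Θ := Θ) (a := a) (b := b) t θ
    rw [hP t ht] at h1
    have : KV Θ a b t θ = 0 := by nlinarith [sq_nonneg (a t * cos (Θ t θ) + b t * sin (Θ t θ))]
    rw [this]; simp) 0 t le_rfl ht
  simp only [zero_mul, abs_nonpos_iff, h.hinit] at this
  simp only [id]
  linarith

/-- Conservation of the mean phase. -/
lemma KSys.mean (h : KSys ρ Θ a b) (t : ℝ) (ht : 0 ≤ t) : ∫ θ, (Θ t θ - θ) ∂ρ = 0 := by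
  have hint : ∀ t, 0 ≤ t → Integrable (fun θ => Θ t θ - θ) ρ := fun t ht =>
    aux_bdd_int ρ _ (2 * |t - 0|) ((h.hcont t ht).sub continuous_id) (fun θ => by
      have := h.lip θ 0 t le_rfl ht
      rwa [h.hinit] at this)
  have hl := aux_lip_cont _ 2 (aux_lip_int ρ (fun t θ => Θ t θ - θ) 2 hint
    (fun θ s t hs ht => by
      have := h.lip θ s t hs ht
      simpa using this))
  have hd : ∀ t, 0 < t → HasDerivAt (fun t => ∫ θ, (Θ t θ - θ) ∂ρ) 0 t := by
    intro t ht
    have := aux_diff_int ρ (fun t θ => Θ t θ - θ) (KV Θ a b) 2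
      (fun t ht => (h.hcont t ht).sub continuous_id) h.V_cont (fun t θ _ => h.V_le t θ) hint
      (fun θ t ht => (h.hode θ t ht).sub_const _) t ht
    have h0 : ∫ θ, KV Θ a b t θ ∂ρ = 0 := by
      unfold KV
      rw [integral_sub ((h.cos_int t ht.le).const_mul _) ((h.sin_int t ht.le).const_mul _),
        integral_const_mul, integral_const_mul, ← h.ha t ht.le, ← h.hb t ht.le]
      ring
    rwa [h0] at this
  have e1 := aux_mono 0 _ (fun _ => 0) hl hd (fun _ _ => le_rfl) 0 t le_rfl ht
  have e2 := aux_mono 0 _ (fun _ => 0) hl.neg (fun t ht => by simpa using (hd t ht).neg)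
    (fun _ _ => le_rfl) 0 t le_rfl ht
  simp only [h.hinit, sub_self, integral_zero, Pi.neg_apply] at e1 e2
  linarith

lemma KSys.P_le (h : KSys ρ Θ a b) (t : ℝ) : a t ^ 2 + b t ^ 2 ≤ 2 := by
  have h1 := (sq_le_one_iff_abs_le_one _).2 (h.ha1 t)
  have h2 := (sq_le_one_iff_abs_le_one _).2 (h.hb1 t)
  linarith

lemma KSys.P_lim (h : KSys ρ Θ a b) (h0 : 0 < a 0 ^ 2 + b 0 ^ 2) :
    ∃ r, 0 < r ∧ Tendsto (fun t => a t ^ 2 + b t ^ 2) atTop (nhds (r ^ 2)) ∧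
      ∀ t, 0 ≤ t → a t ^ 2 + b t ^ 2 ≤ r ^ 2 := by
  set Q : ℝ → ℝ := fun t => a (max t 0) ^ 2 + b (max t 0) ^ 2 with hQ
  have hm : Monotone Q := fun s t hst => h.P_mono _ _ (le_max_right _ _) (max_le_max_right 0 hst)
  have hbd : BddAbove (Set.range Q) := ⟨2, by
    rintro _ ⟨t, rfl⟩
    exact h.P_le _⟩
  have hlim := tendsto_atTop_ciSup hm hbd
  have hle : ∀ t, 0 ≤ t → a t ^ 2 + b t ^ 2 ≤ ⨆ i, Q i := by
    intro t ht
    have := le_ciSup hbd t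
    simpa only [hQ, max_eq_left ht] using this
  have hpos : 0 < ⨆ i, Q i := h0.trans_le (hle 0 le_rfl)
  refine ⟨√(⨆ i, Q i), Real.sqrt_pos.2 hpos, ?_, ?_⟩
  · rw [Real.sq_sqrt hpos.le]
    apply hlim.congr'
    filter_upwards [eventually_ge_atTop 0] with t ht
    simp only [hQ, max_eq_left ht]
  · rw [Real.sq_sqrt hpos.le]
    exact hle

lemma KSys.J_lim (h : KSys ρ Θ a b) (p : ℝ)
    (hp : Tendsto (fun t => a t ^ 2 + b t ^ 2) atTop (nhds p)) :
    Tendsto (KJ ρ Θ a b) atTop (nhds 0) := by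
  rw [Metric.tendsto_atTop]
  intro ε hε
  set δ := ε / 64 with hδ
  have hδ0 : 0 < δ := by positivity
  obtain ⟨T, hT⟩ := Metric.tendsto_atTop.1 hp (δ * ε / 4) (by positivity)
  refine ⟨max T 0, fun t ht => ?_⟩
  have hTt := (le_max_left _ _).trans ht
  have h0t := (le_max_right _ _).trans ht
  obtain ⟨c, hc, hcs⟩ := exists_hasDerivAt_eq_slope (fun t => a t ^ 2 + b t ^ 2)
    (fun t => 2 * KJ ρ Θ a b t) (a := t) (b := t + δ) (by linarith)
    (h.P_cont.mono (fun x hx => h0t.trans hx.1))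
    (fun x hx => h.P_deriv x (h0t.trans_lt hx.1))
  have e1 := hT t hTt
  have e2 := hT (t + δ) (by linarith)
  rw [Real.dist_eq, abs_lt] at e1 e2
  have e3 : 2 * KJ ρ Θ a b c * δ < δ * ε / 2 := by
    simp only [add_sub_cancel_left] at hcs
    rw [hcs, div_mul_cancel₀ _ hδ0.ne']
    linarith [e1.1, e2.2]
  have e4 : KJ ρ Θ a b c < ε / 4 := by
    by_contra hno
    push Not at hno
    nlinarith
  have e5 := h.J_lip c t (h0t.trans hc.1.le) h0t
  have e6 : |t - c| < δ := by
    rw [abs_lt]; constructor <;> linarith [hc.1, hc.2]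
  have e7 := (abs_le.1 e5).2
  have e8 := KSys.J_nonneg (ρ := ρ) (Θ := Θ) (a := a) (b := b) t
  rw [Real.dist_eq, sub_zero, abs_of_nonneg e8]
  linarith

lemma KSys.AB_bound (h : KSys ρ Θ a b) (η : ℝ) (hη : 0 < η) (t : ℝ) (ht : 0 ≤ t) :
    |KA ρ Θ a b t| ≤ η + KJ ρ Θ a b t / η ∧ |KB ρ Θ a b t| ≤ η + KJ ρ Θ a b t / η := by
  have key : ∀ θ, |KV Θ a b t θ| ≤ η + KV Θ a b t θ * KV Θ a b t θ / η := by
    intro θ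
    have : η + KV Θ a b t θ * KV Θ a b t θ / η = (η ^ 2 + |KV Θ a b t θ| ^ 2) / η := by
      rw [sq_abs]; field_simp
    rw [this, le_div_iff₀ hη]
    nlinarith [sq_nonneg (η - |KV Θ a b t θ|), sq_nonneg η, sq_nonneg (|KV Θ a b t θ|)]
  have hI : Integrable (fun θ => η + KV Θ a b t θ * KV Θ a b t θ / η) ρ :=
    (integrable_const _).add ((h.VV_int t ht).div_const _)
  have hE : ∫ θ, (η + KV Θ a b t θ * KV Θ a b t θ / η) ∂ρ = η + KJ ρ Θ a b t / η := by
    rw [integral_add (integrable_const _) ((h.VV_int t ht).div_const _), integral_div]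
    simp [KJ]
  rw [← hE]
  constructor
  · exact norm_integral_le_of_norm_le (f := fun θ => -sin (Θ t θ) * KV Θ a b t θ) hI
      (Eventually.of_forall fun θ => (h.sV_le t θ).trans (key θ))
  · exact norm_integral_le_of_norm_le (f := fun θ => cos (Θ t θ) * KV Θ a b t θ) hI
      (Eventually.of_forall fun θ => (h.cV_le t θ).trans (key θ))

lemma KSys.AB_lim (h : KSys ρ Θ a b) (hJ : Tendsto (KJ ρ Θ a b) atTop (nhds 0)) :
    Tendsto (KA ρ Θ a b) atTop (nhds 0) ∧ Tendsto (KB ρ Θ a b) atTop (nhds 0) := by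
  have key : ∀ ε > 0, ∃ N, ∀ t ≥ N, |KA ρ Θ a b t| < ε ∧ |KB ρ Θ a b t| < ε := by
    intro ε hε
    obtain ⟨T, hT⟩ := Metric.tendsto_atTop.1 hJ (ε / 2 * (ε / 2)) (by positivity)
    refine ⟨max T 0, fun t ht => ?_⟩
    have e1 := hT t ((le_max_left _ _).trans ht)
    rw [Real.dist_eq, sub_zero, abs_lt] at e1
    have e2 := h.AB_bound (ε / 2) (by positivity) t ((le_max_right _ _).trans ht)
    have e3 : KJ ρ Θ a b t / (ε / 2) < ε / 2 := (div_lt_iff₀ (by positivity)).2 e1.2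
    constructor <;> linarith [e2.1, e2.2]
  constructor
  · rw [Metric.tendsto_atTop]
    intro ε hε
    obtain ⟨N, hN⟩ := key ε hε
    exact ⟨N, fun t ht => by rw [Real.dist_eq, sub_zero]; exact (hN t ht).1⟩
  · rw [Metric.tendsto_atTop]
    intro ε hε
    obtain ⟨N, hN⟩ := key ε hε
    exact ⟨N, fun t ht => by rw [Real.dist_eq, sub_zero]; exact (hN t ht).2⟩

noncomputable def KG (Θ : ℝ → ℝ → ℝ) (a b : ℝ → ℝ) (θ t : ℝ) : ℝ :=
  a t * cos (Θ t θ) + b t * sin (Θ t θ)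

lemma KSys.G_le (h : KSys ρ Θ a b) (θ t : ℝ) : |KG Θ a b θ t| ≤ 2 := by
  unfold KG
  refine (abs_add_le _ _).trans ?_
  rw [abs_mul, abs_mul]
  have h1 := mul_le_mul (h.ha1 t) (abs_cos_le_one (Θ t θ)) (abs_nonneg _) zero_le_one
  have h2 := mul_le_mul (h.hb1 t) (abs_sin_le_one (Θ t θ)) (abs_nonneg _) zero_le_one
  linarith

lemma KSys.dich (h : KSys ρ Θ a b) (r : ℝ) (hr : 0 < r)
    (hp : Tendsto (fun t => a t ^ 2 + b t ^ 2) atTop (nhds (r ^ 2)))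
    (hle : ∀ t, 0 ≤ t → a t ^ 2 + b t ^ 2 ≤ r ^ 2) (θ : ℝ) :
    Tendsto (KG Θ a b θ) atTop (nhds r) ∨ Tendsto (KG Θ a b θ) atTop (nhds (-r)) := by
  obtain ⟨hA, hB⟩ := h.AB_lim (h.J_lim _ hp)
  refine aux_dich (KG Θ a b θ) (fun t => (a t ^ 2 + b t ^ 2 - r ^ 2) +
    (KA ρ Θ a b t * cos (Θ t θ) + KB ρ Θ a b t * sin (Θ t θ))) r hr ?_ ?_ ?_
  · intro t ht
    have h1 := ((h.a_deriv t ht).mul (h.hode θ t ht.le).cos).add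
      ((h.b_deriv t ht).mul (h.hode θ t ht.le).sin)
    have h2 := KV_sq (Θ := Θ) (a := a) (b := b) t θ
    have e : r ^ 2 - KG Θ a b θ t ^ 2 + ((a t ^ 2 + b t ^ 2 - r ^ 2) +
      (KA ρ Θ a b t * cos (Θ t θ) + KB ρ Θ a b t * sin (Θ t θ))) =
      KA ρ Θ a b t * cos (Θ t θ) + a t * (-sin (Θ t θ) * (b t * cos (Θ t θ) - a t * sin (Θ t θ)))
      + (KB ρ Θ a b t * sin (Θ t θ) +
        b t * (cos (Θ t θ) * (b t * cos (Θ t θ) - a t * sin (Θ t θ)))) := by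
      unfold KV at h2
      unfold KG
      linear_combination -h2
    rw [e]
    exact h1
  · have hs : Tendsto (fun t => |a t ^ 2 + b t ^ 2 - r ^ 2| + (|KA ρ Θ a b t| + |KB ρ Θ a b t|))
        atTop (nhds 0) := by
      have := ((hp.sub_const (r ^ 2)).abs).add (hA.abs.add hB.abs)
      simpa using this
    refine squeeze_zero_norm (fun t => ?_) hs
    rw [Real.norm_eq_abs]
    refine (abs_add_le _ _).trans (add_le_add le_rfl ((abs_add_le _ _).trans ?_))
    rw [abs_mul, abs_mul]
    exact add_le_add (mul_le_of_le_one_right (abs_nonneg _) (abs_cos_le_one _))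
      (mul_le_of_le_one_right (abs_nonneg _) (abs_sin_le_one _))
  · intro t ht
    apply abs_le_of_sq_le_sq _ hr.le
    have h2 := KV_sq (Θ := Θ) (a := a) (b := b) t θ
    have h3 := hle t ht.le
    unfold KG
    nlinarith [mul_self_nonneg (KV Θ a b t θ)]

lemma KSys.d_cont (h : KSys ρ Θ a b) (θ₁ θ₂ : ℝ) :
    ContinuousOn (fun t => Θ t θ₁ - Θ t θ₂) (Set.Ici 0) := fun t ht =>
  ((h.hode θ₁ t ht).sub (h.hode θ₂ t ht)).continuousAt.continuousWithinAt

lemma KSys.q_deriv (h : KSys ρ Θ a b) (θ₁ θ₂ t : ℝ) (ht : 0 ≤ t) :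
    HasDerivAt (fun t => 2 - 2 * cos (Θ t θ₁ - Θ t θ₂))
      (-(KG Θ a b θ₁ t + KG Θ a b θ₂ t) * (2 - 2 * cos (Θ t θ₁ - Θ t θ₂))) t := by
  have h1 := ((((h.hode θ₁ t ht).sub (h.hode θ₂ t ht)).cos).const_mul 2).const_sub 2
  refine h1.congr_deriv ?_
  try simp only [Pi.sub_apply]
  unfold KG
  rw [cos_sub, sin_sub]
  have e1 := sin_sq_add_cos_sq (Θ t θ₁)
  have e2 := sin_sq_add_cos_sq (Θ t θ₂)
  generalize cos (Θ t θ₁) = c1 at *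
  generalize sin (Θ t θ₁) = s1 at *
  generalize cos (Θ t θ₂) = c2 at *
  generalize sin (Θ t θ₂) = s2 at *
  linear_combination (2 * a t * c2 + 2 * b t * s2) * (-e1) + (2 * a t * c1 + 2 * b t * s1) * (-e2)

lemma KSys.q_zero (h : KSys ρ Θ a b) (θ₁ θ₂ s t : ℝ) (hs : 0 ≤ s) (ht : 0 ≤ t)
    (h0 : cos (Θ s θ₁ - Θ s θ₂) = 1) : cos (Θ t θ₁ - Θ t θ₂) = 1 := by
  have := aux_exp_bounds (fun t => 2 - 2 * cos (Θ t θ₁ - Θ t θ₂))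
    (fun t => -(KG Θ a b θ₁ t + KG Θ a b θ₂ t)) 4
    (fun t ht => (h.q_deriv θ₁ θ₂ t ht).continuousAt.continuousWithinAt)
    (fun t ht => h.q_deriv θ₁ θ₂ t ht.le)
    (fun t ht => by
      rw [abs_neg]
      refine (abs_add_le _ _).trans ?_
      linarith [h.G_le θ₁ t, h.G_le θ₂ t])
    (fun t => by linarith [cos_le_one (Θ t θ₁ - Θ t θ₂)]) s t hs ht (by simp only [h0]; norm_num)
  linarith

lemma KSys.d_bound (h : KSys ρ Θ a b) (θ₁ θ₂ t : ℝ) (ht : 0 ≤ t) :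
    |(Θ t θ₁ - Θ t θ₂) - (θ₁ - θ₂)| ≤ 2 * π := by
  have := aux_stay (fun t => Θ t θ₁ - Θ t θ₂) (h.d_cont θ₁ θ₂)
    (fun s t hs ht h0 => h.q_zero θ₁ θ₂ s t hs ht h0) t ht
  simpa only [h.hinit] using this

lemma KSys.exceptional (h : KSys ρ Θ a b) (r : ℝ) (hr : 0 < r) (θ₁ θ₂ : ℝ)
    (h1 : Tendsto (KG Θ a b θ₁) atTop (nhds (-r))) (h2 : Tendsto (KG Θ a b θ₂) atTop (nhds (-r))) :
    cos (θ₁ - θ₂) = 1 := by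
  have hs : Tendsto (fun t => -(KG Θ a b θ₁ t + KG Θ a b θ₂ t)) atTop (nhds (-(-r + -r))) :=
    (h1.add h2).neg
  obtain ⟨T, hT⟩ := eventually_atTop.1 (hs.eventually_const_le (show r < -(-r + -r) by linarith))
  have hz := aux_growth (fun t => 2 - 2 * cos (Θ t θ₁ - Θ t θ₂))
    (fun t => -(KG Θ a b θ₁ t + KG Θ a b θ₂ t)) r (max T 0) hr
    (fun t ht => h.q_deriv θ₁ θ₂ t ((le_max_right _ _).trans ht.le))
    (fun t ht => (h.q_deriv θ₁ θ₂ t ((le_max_right T 0).trans ht)).continuousAt.continuousWithinAt)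
    (fun t ht => hT t ((le_max_left _ _).trans ht.le))
    (fun t => by linarith [cos_le_one (Θ t θ₁ - Θ t θ₂)])
    (fun t => by linarith [neg_one_le_cos (Θ t θ₁ - Θ t θ₂)])
  have := h.q_zero θ₁ θ₂ (max T 0) 0 (le_max_right _ _) le_rfl (by linarith)
  simpa only [h.hinit] using this

lemma KSys.sync (h : KSys ρ Θ a b) (r : ℝ) (hr : 0 < r)
    (hp : Tendsto (fun t => a t ^ 2 + b t ^ 2) atTop (nhds (r ^ 2))) (θ₁ θ₂ : ℝ)
    (h1 : Tendsto (KG Θ a b θ₁) atTop (nhds r)) (h2 : Tendsto (KG Θ a b θ₂) atTop (nhds r)) :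
    ∃ L, Tendsto (fun t => Θ t θ₁ - Θ t θ₂) atTop (nhds L) ∧ cos L = 1 := by
  refine aux_conv _ (2 * π + |θ₁ - θ₂|) (h.d_cont θ₁ θ₂) (fun t ht => ?_) ?_
  · have := h.d_bound θ₁ θ₂ t ht
    have e : Θ t θ₁ - Θ t θ₂ = ((Θ t θ₁ - Θ t θ₂) - (θ₁ - θ₂)) + (θ₁ - θ₂) := by ring
    rw [e]
    exact (abs_add_le _ _).trans (by linarith)
  · have hV : ∀ θ, Tendsto (KG Θ a b θ) atTop (nhds r) →
        Tendsto (fun t => KV Θ a b t θ * KV Θ a b t θ) atTop (nhds 0) := by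
      intro θ hθ
      have := hp.sub (hθ.pow 2)
      rw [sub_self] at this
      refine this.congr (fun t => ?_)
      rw [KV_sq]; rfl
    have hVV : Tendsto (fun t => KV Θ a b t θ₁ * KV Θ a b t θ₂) atTop (nhds 0) := by
      have := (hV θ₁ h1).add (hV θ₂ h2)
      rw [add_zero] at this
      refine squeeze_zero_norm (fun t => ?_) this
      rw [Real.norm_eq_abs, abs_le]
      constructor <;> nlinarith [sq_nonneg (KV Θ a b t θ₁ - KV Θ a b t θ₂),
        sq_nonneg (KV Θ a b t θ₁ + KV Θ a b t θ₂), sq_nonneg (KV Θ a b t θ₁),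
        sq_nonneg (KV Θ a b t θ₂)]
    have hq := ((h1.mul h2).add hVV).div hp (by positivity)
    have e : (r * r + 0) / r ^ 2 = 1 := by field_simp; ring
    rw [e] at hq
    refine hq.congr' ?_
    filter_upwards [hp.eventually_ne (show r ^ 2 ≠ 0 by positivity)] with t ht
    rw [Pi.div_apply]
    rw [div_eq_iff ht, cos_sub]
    unfold KG KV
    ring

lemma KSys.main (h : KSys ρ Θ a b) (h0 : 0 < a 0 ^ 2 + b 0 ^ 2)
    (hnonatomic : ∀ a : ℝ, ρ {θ : ℝ | ∃ m : ℤ, θ - a = 2 * π * m} = 0) :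
    ∃ φstar : ℝ,
      ∀ h : ℝ → ℝ, Continuous h → Function.Periodic h (2*π) →
        Tendsto (fun t => ∫ θ, h (Θ t θ) ∂ρ) atTop (nhds (h φstar)) := by
  obtain ⟨r, hr, hp, hle⟩ := h.P_lim h0
  have hdich := h.dich r hr hp hle
  have hae : ∀ᵐ θ ∂ρ, Tendsto (KG Θ a b θ) atTop (nhds r) := by
    by_cases hex : ∃ c, Tendsto (KG Θ a b c) atTop (nhds (-r))
    · obtain ⟨c, hc⟩ := hex
      have : ∀ᵐ θ ∂ρ, ¬ ∃ m : ℤ, θ - c = 2 * π * m := by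
        rw [ae_iff]
        simpa only [not_not] using hnonatomic c
      filter_upwards [this] with θ hθ
      refine (hdich θ).resolve_right fun hbad => hθ ?_
      obtain ⟨m, hm⟩ := (cos_eq_one_iff _).1 (h.exceptional r hr θ c hbad hc)
      exact ⟨m, by rw [← hm]; ring⟩
    · push Not at hex
      exact Eventually.of_forall fun θ => (hdich θ).resolve_right (hex θ)
  obtain ⟨θ₀, hθ₀⟩ := hae.exists
  have hL : ∀ θ, ∃ L, Tendsto (KG Θ a b θ) atTop (nhds r) →
      Tendsto (fun t => Θ t θ - Θ t θ₀) atTop (nhds L) ∧ cos L = 1 := by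
    intro θ
    by_cases hθ : Tendsto (KG Θ a b θ) atTop (nhds r)
    · obtain ⟨L, hL⟩ := h.sync r hr hp θ θ₀ hθ hθ₀
      exact ⟨L, fun _ => hL⟩
    · exact ⟨0, fun hh => absurd hh hθ⟩
  choose L hL using hL
  have hlim : Tendsto (fun t => ∫ θ, ((Θ t θ - Θ t θ₀) - (θ - θ₀)) ∂ρ) atTop
      (nhds (∫ θ, (L θ - (θ - θ₀)) ∂ρ)) := by
    refine tendsto_integral_filter_of_dominated_convergence (fun _ => 2 * π) ?_ ?_
      (integrable_const _) ?_
    · filter_upwards [eventually_ge_atTop 0] with t ht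
      have := h.hcont t ht
      exact Continuous.aestronglyMeasurable (by fun_prop)
    · filter_upwards [eventually_ge_atTop 0] with t ht
      exact Eventually.of_forall fun θ => h.d_bound θ θ₀ t ht
    · filter_upwards [hae] with θ hθ
      exact (hL θ hθ).1.sub_const _
  have hΘ₀ : ∀ t, 0 ≤ t → ∫ θ, ((Θ t θ - Θ t θ₀) - (θ - θ₀)) ∂ρ = θ₀ - Θ t θ₀ := by
    intro t ht
    have hint : Integrable (fun θ => Θ t θ - θ) ρ :=
      aux_bdd_int ρ _ (2 * |t - 0|) ((h.hcont t ht).sub continuous_id) (fun θ => by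
        have := h.lip θ 0 t le_rfl ht
        rwa [h.hinit] at this)
    have e : ∀ θ, (Θ t θ - Θ t θ₀) - (θ - θ₀) = (Θ t θ - θ) + (θ₀ - Θ t θ₀) := fun θ => by ring
    simp only [e]
    rw [integral_add hint (integrable_const _), h.mean t ht]
    simp
  have hconv : ∃ φ, Tendsto (fun t => Θ t θ₀) atTop (nhds φ) := by
    refine ⟨θ₀ - ∫ θ, (L θ - (θ - θ₀)) ∂ρ, (hlim.const_sub θ₀).congr' ?_⟩
    filter_upwards [eventually_ge_atTop 0] with t ht
    rw [hΘ₀ t ht]; ring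
  obtain ⟨φ, hφ⟩ := hconv
  refine ⟨φ, fun f hf hper => ?_⟩
  obtain ⟨M, hM⟩ : ∃ M, ∀ x, |f x| ≤ M := by
    obtain ⟨M, hM⟩ := (hper.isBounded_of_continuous (by positivity) hf).exists_norm_le
    exact ⟨M, fun x => hM _ ⟨x, rfl⟩⟩
  have e : f φ = ∫ θ, f φ ∂ρ := by simp
  rw [e]
  refine tendsto_integral_filter_of_dominated_convergence (fun _ => M) ?_ ?_
    (integrable_const _) ?_
  · filter_upwards [eventually_ge_atTop 0] with t ht
    exact (hf.comp (h.hcont t ht)).aestronglyMeasurable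
  · exact Eventually.of_forall fun t => Eventually.of_forall fun θ => hM _
  · filter_upwards [hae] with θ hθ
    obtain ⟨h1, h2⟩ := hL θ hθ
    have h3 : Tendsto (fun t => Θ t θ) atTop (nhds (φ + L θ)) := by
      have := hφ.add h1
      refine this.congr fun t => by ring
    obtain ⟨m, hm⟩ := (cos_eq_one_iff _).1 h2
    have h4 : f (φ + L θ) = f φ := by
      rw [← hm]
      exact hper.int_mul m φ
    rw [← h4]
    exact (hf.tendsto _).comp h3

end

/-- Every non-stationary solution of the kinetic Kuramoto model of identical oscillators
with non-atomic (mod 2π) initial measure converges weak-* to a completely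
phase-synchronized state: there is `φ* ∈ ℝ` such that for every continuous 2π-periodic
`h`, `∫ h(Θ(t,θ)) dρ₀(θ) → h(φ*)`, i.e. `ρ(t,·) → δ_{φ*}`. -/
theorem kinetic_kuramoto_complete_phase_synchronization
    (ρ₀ : Measure ℝ) [IsProbabilityMeasure ρ₀]
    (Θ : ℝ → ℝ → ℝ) (z : ℝ → ℂ)
    (hz : ∀ t, z t = ∫ θ, Complex.exp (Complex.I * (Θ t θ : ℂ)) ∂ρ₀)
    (hinit : ∀ θ, Θ 0 θ = θ)
    (hode : ∀ θ : ℝ, ∀ t ≥ (0:ℝ),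
      HasDerivAt (fun s => Θ s θ)
        (-(Complex.exp (Complex.I * (Θ t θ : ℂ)) * (starRingEnd ℂ) (z t)).im) t)
    (hnonstat : ¬ (∀ t ≥ (0:ℝ), Measure.map (Θ t) ρ₀ = ρ₀))
    (hnonatomic : ∀ a : ℝ, ρ₀ {θ : ℝ | ∃ m : ℤ, θ - a = 2 * π * m} = 0) :
    ∃ φstar : ℝ,
      ∀ h : ℝ → ℝ, Continuous h → Function.Periodic h (2*π) →
        Tendsto (fun t => ∫ θ, h (Θ t θ) ∂ρ₀) atTop (nhds (h φstar)) := by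
  have hz1 : ∀ t, ‖z t‖ ≤ 1 := by
    intro t
    rw [hz t]
    have := norm_integral_le_of_norm_le_const (μ := ρ₀)
      (f := fun θ => Complex.exp (Complex.I * (Θ t θ : ℂ))) (C := 1)
      (Eventually.of_forall fun θ => by
        rw [mul_comm, Complex.norm_exp_ofReal_mul_I])
    simpa using this
  have hre : ∀ x : ℝ, (Complex.exp (Complex.I * (x : ℂ))).re = cos x := fun x => by
    rw [mul_comm, Complex.exp_ofReal_mul_I_re]
  have him : ∀ x : ℝ, (Complex.exp (Complex.I * (x : ℂ))).im = sin x := fun x => by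
    rw [mul_comm, Complex.exp_ofReal_mul_I_im]
  have ha1 : ∀ t, |(z t).re| ≤ 1 := fun t => (Complex.abs_re_le_norm _).trans (hz1 t)
  have hb1 : ∀ t, |(z t).im| ≤ 1 := fun t => (Complex.abs_im_le_norm _).trans (hz1 t)
  have hode' : ∀ θ t, 0 ≤ t → HasDerivAt (fun s => Θ s θ)
      ((z t).im * cos (Θ t θ) - (z t).re * sin (Θ t θ)) t := by
    intro θ t ht
    refine (hode θ t ht).congr_deriv ?_
    rw [Complex.mul_im, hre, him, Complex.conj_re, Complex.conj_im]
    ring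
  have hcont : ∀ t, 0 ≤ t → Continuous (Θ t) := by
    intro t ht
    have hlip : LipschitzWith (Real.toNNReal (exp (2 * t))) (Θ t) := by
      apply LipschitzWith.of_dist_le_mul
      intro x y
      have := dist_le_of_trajectories_ODE (E := ℝ)
        (v := fun t x => (z t).im * cos x - (z t).re * sin x) (K := 2)
        (f := fun s => Θ s x) (g := fun s => Θ s y) (a := 0) (b := t) (δ := dist x y)
        (fun s => by
          apply LipschitzWith.of_dist_le_mul
          intro u v
          rw [Real.dist_eq, Real.dist_eq]
          have e : (z s).im * cos u - (z s).re * sin u - ((z s).im * cos v - (z s).re * sin v)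
            = (z s).im * (cos u - cos v) - (z s).re * (sin u - sin v) := by ring
          rw [e]
          refine (abs_sub _ _).trans ?_
          rw [abs_mul, abs_mul]
          have h1 := mul_le_mul (hb1 s) (aux_cos_lip u v) (abs_nonneg _) zero_le_one
          have h2 := mul_le_mul (ha1 s) (aux_sin_lip u v) (abs_nonneg _) zero_le_one
          have : ((2 : NNReal) : ℝ) = 2 := rfl
          rw [this]
          linarith)
        (fun s hs => (hode' x s hs.1).continuousAt.continuousWithinAt)
        (fun s hs => (hode' x s hs.1).hasDerivWithinAt)
        (fun s hs => (hode' y s hs.1).continuousAt.continuousWithinAt)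
        (fun s hs => (hode' y s hs.1).hasDerivWithinAt)
        (by simp only [hinit]; exact le_rfl) t ⟨ht, le_rfl⟩
      rw [Real.coe_toNNReal _ (exp_pos _).le, mul_comm]
      simpa using this
    exact hlip.continuous
  have hint : ∀ t, 0 ≤ t → Integrable (fun θ => Complex.exp (Complex.I * (Θ t θ : ℂ))) ρ₀ := by
    intro t ht
    have := hcont t ht
    refine Integrable.of_bound (Continuous.aestronglyMeasurable (by fun_prop)) 1
      (Eventually.of_forall fun θ => ?_)
    rw [mul_comm, Complex.norm_exp_ofReal_mul_I]
  have hsys : KSys ρ₀ Θ (fun t => (z t).re) (fun t => (z t).im) :=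
    { ha := fun t ht => by
        have := integral_re (hint t ht)
        simp only [RCLike.re_to_complex, hre] at this
        rw [this, hz t]
      hb := fun t ht => by
        have := integral_im (hint t ht)
        simp only [RCLike.im_to_complex, him] at this
        rw [this, hz t]
      ha1 := ha1
      hb1 := hb1
      hinit := hinit
      hcont := hcont
      hode := hode' }
  have hpos : 0 < (z 0).re ^ 2 + (z 0).im ^ 2 := by
    by_contra hno
    apply hnonstat
    intro t ht
    rw [hsys.stationary (le_antisymm (not_lt.1 hno) (by positivity)) t ht, Measure.map_id]
  exact hsys.main hpos hnonatomic
end
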